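/- arXiv:1901.05402 — 9 statements merged into one kernel-verified Lean document; each statement's English description precedes it below -/
import Mathlib

section
/- Let K = {(x,t) ∈ ℝ³×ℝ : x ≠ 0, −|x| < t} and let α : K → ℝ be a continuous function which is smooth on K ∩ {t ≥ |x|} and smooth on K ∩ {t ≤ |x|}, and which satisfies: ∂ₜ²α − Δₓα = 0 on the open regions {|x| > 1, t > |x|} and {|x| > 1, −|x| < t < |x|}; α(x,t) = 0 whenever 1 ≤ t ≤ |x|; and α(x,t) = 0 whenever |x| = 1 and −1 < t ≤ 3. Then α(x,t) = 0 for every (x,t) with |x| ≥ 1 and −1 < t ≤ 3. -/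
/-- Second directional derivative of `f` at `p` in direction `v`. -/
noncomputable def dir2 {E : Type*} [NormedAddCommGroup E] [NormedSpace ℝ E]
    (f : E → ℝ) (p v : E) : ℝ :=
  iteratedDeriv 2 (fun s : ℝ => f (p + s • v)) 0

/-- The wave operator `□u = ∂ₜ²u − Δₓu` on `ℝ³ × ℝ`. -/
noncomputable def waveOp3 (u : EuclideanSpace ℝ (Fin 3) × ℝ → ℝ)
    (p : EuclideanSpace ℝ (Fin 3) × ℝ) : ℝ :=
  dir2 u p (0, 1) - ∑ i : Fin 3, dir2 u p (EuclideanSpace.single i 1, 0)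

open MeasureTheory Set Filter Topology

/-- Space-time `ℝ³ × ℝ`. -/
abbrev Spacetime := EuclideanSpace ℝ (Fin 3) × ℝ

/-- The time derivative `∂ₜu`. -/
noncomputable def timeDeriv (u : Spacetime → ℝ) (p : Spacetime) : ℝ :=
  fderiv ℝ u p (0, 1)

/-- The spatial derivative `∂ᵢu`. -/
noncomputable def spaceDeriv (u : Spacetime → ℝ) (i : Fin 3) (p : Spacetime) : ℝ :=
  fderiv ℝ u p (EuclideanSpace.single i 1, 0)

/-- The energy density `(|∂ₜu|² + |∇u|²) / 2`. -/
noncomputable def energyDensity (u : Spacetime → ℝ) (p : Spacetime) : ℝ :=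
  (timeDeriv u p ^ 2 + ∑ i, spaceDeriv u i p ^ 2) / 2

/-- The pairing of `dχ` with the energy current `((|∂ₜu|² + |∇u|²) / 2, -∂ₜu ∇u)`. -/
noncomputable def currentPairing (χ u : Spacetime → ℝ) (p : Spacetime) : ℝ :=
  timeDeriv χ p * energyDensity u p -
    ∑ i, spaceDeriv χ i p * (timeDeriv u p * spaceDeriv u i p)

theorem dir2_eq_fderiv_fderiv {E : Type*} [NormedAddCommGroup E] [NormedSpace ℝ E]
    {u : E → ℝ} {p : E} (hu : ContDiffAt ℝ 2 u p) (v : E) :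
    dir2 u p v = fderiv ℝ (fun q => fderiv ℝ u q v) p v := by
  have hline : ∀ s : ℝ, HasDerivAt (fun s : ℝ => p + s • v) v s := fun s => by
    simpa using ((hasDerivAt_id s).smul_const v).const_add p
  have hlim : Tendsto (fun s : ℝ => p + s • v) (𝓝 0) (𝓝 p) := by
    have := (hline 0).continuousAt.tendsto
    simpa using this
  have hev : ∀ᶠ s : ℝ in 𝓝 0, ContDiffAt ℝ 2 u (p + s • v) :=
    hlim.eventually (hu.eventually (by simp))
  have hderiv : deriv (fun s : ℝ => u (p + s • v)) =ᶠ[𝓝 0]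
      fun s => fderiv ℝ u (p + s • v) v := by
    filter_upwards [hev] with s hs
    exact ((hs.differentiableAt (by simp)).hasFDerivAt.comp_hasDerivAt s (hline s)).deriv
  have hdiff : DifferentiableAt ℝ (fun q => fderiv ℝ u q v) p :=
    ((hu.fderiv_right (m := 1) (by norm_num)).differentiableAt (by simp)).clm_apply
      (differentiableAt_const v)
  rw [dir2, iteratedDeriv_succ, iteratedDeriv_one, hderiv.deriv_eq]
  have h0 : HasFDerivAt (fun q => fderiv ℝ u q v) (fderiv ℝ (fun q => fderiv ℝ u q v) p)
      (p + (0 : ℝ) • v) := by simpa using hdiff.hasFDerivAt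
  exact (h0.comp_hasDerivAt (0 : ℝ) (hline 0)).deriv

theorem fderiv_fderiv_apply_comm {E : Type*} [NormedAddCommGroup E] [NormedSpace ℝ E]
    {u : E → ℝ} {p : E} (hu : ContDiffAt ℝ 2 u p) (v w : E) :
    fderiv ℝ (fun q => fderiv ℝ u q v) p w = fderiv ℝ (fun q => fderiv ℝ u q w) p v := by
  have hd : DifferentiableAt ℝ (fderiv ℝ u) p :=
    (hu.fderiv_right (m := 1) (by norm_num)).differentiableAt (by simp)
  have key : ∀ v w : E, fderiv ℝ (fun q => fderiv ℝ u q v) p w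
      = fderiv ℝ (fderiv ℝ u) p w v := fun v w => by
    rw [fderiv_clm_apply hd (differentiableAt_const v)]
    simp
  rw [key, key]
  exact hu.isSymmSndFDerivAt (by simp) w v

theorem integral_fderiv_apply_eq_zero {W : Spacetime → ℝ} (hW : ContDiff ℝ 1 W)
    (hc : HasCompactSupport W) (v : Spacetime) : ∫ p, fderiv ℝ W p v = 0 := by
  have hInt : Integrable (fun p => fderiv ℝ W p v) :=
    ((hW.continuous_fderiv (by simp)).clm_apply continuous_const).integrable_of_hasCompactSupport
      (hc.fderiv_apply (𝕜 := ℝ) v)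
  have : (volume : Measure Spacetime).IsAddHaarMeasure :=
    inferInstanceAs ((volume : Measure (EuclideanSpace ℝ (Fin 3))).prod
      (volume : Measure ℝ)).IsAddHaarMeasure
  have := integral_mul_fderiv_eq_neg_fderiv_mul_of_integrable (μ := (volume : Measure Spacetime))
    (f := fun _ => (1 : ℝ)) (g := W) (v := v) (𝕜 := ℝ) (by simp) (by simpa using hInt)
    (by simpa using hW.continuous.integrable_of_hasCompactSupport hc)
    (fun _ _ => differentiableAt_const _) (fun x _ => (hW.differentiable (by simp)) x)
  simpa using this

theorem contDiff_mul_of_tsupport_subset {Ω : Set Spacetime} (hΩ : IsOpen Ω)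
    {χ P : Spacetime → ℝ} (hχ : ContDiffOn ℝ 1 χ Ω) (hP : ContDiffOn ℝ 1 P Ω)
    (hs : tsupport χ ⊆ Ω) : ContDiff ℝ 1 (fun p => χ p * P p) := by
  refine contDiff_iff_contDiffAt.2 fun p => ?_
  by_cases hp : p ∈ Ω
  · exact (hχ.mul hP).contDiffAt (hΩ.mem_nhds hp)
  · have h0 : χ =ᶠ[𝓝 p] 0 := notMem_tsupport_iff_eventuallyEq.1 fun h => hp (hs h)
    refine (contDiffAt_const (c := (0 : ℝ))).congr_of_eventuallyEq ?_
    filter_upwards [h0] with q hq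
    simp [hq]

theorem currentPairing_eq_zero_of_notMem_tsupport {χ : Spacetime → ℝ} (u : Spacetime → ℝ)
    {p : Spacetime} (hp : p ∉ tsupport χ) : currentPairing χ u p = 0 := by
  have h0 : fderiv ℝ χ p = 0 := by
    rw [(notMem_tsupport_iff_eventuallyEq.1 hp).fderiv_eq]
    simp
  simp [currentPairing, timeDeriv, spaceDeriv, h0]

/-- The divergence identity for the energy current of a solution of the wave equation. -/
theorem continuous_and_integral_currentPairing_eq_zero {Ω : Set Spacetime} (hΩ : IsOpen Ω)
    {u χ : Spacetime → ℝ} (hu : ContDiffOn ℝ 2 u Ω) (hw : ∀ p ∈ Ω, waveOp3 u p = 0)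
    (hχ : ContDiffOn ℝ 1 χ Ω) (hc : HasCompactSupport χ) (hs : tsupport χ ⊆ Ω) :
    Continuous (currentPairing χ u) ∧ ∫ p, currentPairing χ u p = 0 := by
  have hD : ∀ v : Spacetime, ContDiffOn ℝ 1 (fun q => fderiv ℝ u q v) Ω := fun v =>
    (hu.fderiv_of_isOpen hΩ (m := 1) (by norm_num)).clm_apply contDiffOn_const
  have ht : ContDiffOn ℝ 1 (timeDeriv u) Ω := hD _
  have hx : ∀ i, ContDiffOn ℝ 1 (spaceDeriv u i) Ω := fun i => hD _
  have he : ContDiffOn ℝ 1 (energyDensity u) Ω :=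
    ((ht.pow 2).add (ContDiffOn.sum fun i _ => (hx i).pow 2)).div_const 2
  have hm : ∀ i, ContDiffOn ℝ 1 (fun p => timeDeriv u p * spaceDeriv u i p) Ω :=
    fun i => ht.mul (hx i)
  set W₀ : Spacetime → ℝ := fun p => χ p * energyDensity u p with hW₀
  set W : Fin 3 → Spacetime → ℝ :=
    fun i p => χ p * (timeDeriv u p * spaceDeriv u i p) with hW
  have c₀ : ContDiff ℝ 1 W₀ := contDiff_mul_of_tsupport_subset hΩ hχ he hs
  have c : ∀ i, ContDiff ℝ 1 (W i) := fun i => contDiff_mul_of_tsupport_subset hΩ hχ (hm i) hs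
  have k₀ : HasCompactSupport W₀ := hc.mul_right
  have k : ∀ i, HasCompactSupport (W i) := fun i => hc.mul_right
  have hpair : currentPairing χ u = fun p => fderiv ℝ W₀ p (0, 1) -
      ∑ i, fderiv ℝ (W i) p (EuclideanSpace.single i 1, 0) := by
    funext p
    by_cases hp : p ∈ tsupport χ
    · have hpΩ := hs hp
      have hnhds := hΩ.mem_nhds hpΩ
      have hu2 : ContDiffAt ℝ 2 u p := hu.contDiffAt hnhds
      have dχ : DifferentiableAt ℝ χ p := (hχ.contDiffAt hnhds).differentiableAt (by simp)
      have dt : DifferentiableAt ℝ (timeDeriv u) p :=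
        (ht.contDiffAt hnhds).differentiableAt (by simp)
      have dx : ∀ i, DifferentiableAt ℝ (spaceDeriv u i) p := fun i =>
        ((hx i).contDiffAt hnhds).differentiableAt (by simp)
      have e₀ : HasFDerivAt (energyDensity u) ((1 / 2 : ℝ) • (((2 : ℝ) * timeDeriv u p) •
          fderiv ℝ (timeDeriv u) p +
          ∑ i, ((2 : ℝ) * spaceDeriv u i p) • fderiv ℝ (spaceDeriv u i) p)) p := by
        have h := ((dt.hasFDerivAt.pow 2).add (HasFDerivAt.fun_sum (u := Finset.univ)
          fun i _ => (dx i).hasFDerivAt.pow 2)).const_mul (1 / 2 : ℝ)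
        refine (h.congr_fderiv ?_).congr_of_eventuallyEq (Eventually.of_forall fun q => ?_)
        · simp
        · simp [energyDensity]; ring
      have f₀ := (dχ.hasFDerivAt.mul e₀).fderiv
      have f₁ := fun i => (dχ.hasFDerivAt.mul (dt.hasFDerivAt.mul (dx i).hasFDerivAt)).fderiv
      have hwave := hw p hpΩ
      rw [waveOp3, dir2_eq_fderiv_fderiv hu2] at hwave
      simp only [dir2_eq_fderiv_fderiv hu2] at hwave
      have hcomm : ∀ i, fderiv ℝ (timeDeriv u) p (EuclideanSpace.single i 1, 0)
          = fderiv ℝ (spaceDeriv u i) p (0, 1) := fun i => fderiv_fderiv_apply_comm hu2 _ _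
      change fderiv ℝ (timeDeriv u) p (0, 1) -
        ∑ i, fderiv ℝ (spaceDeriv u i) p (EuclideanSpace.single i 1, 0) = 0 at hwave
      have g₀ : fderiv ℝ W₀ p = _ := f₀
      have g₁ : ∀ i, fderiv ℝ (W i) p = _ := f₁
      rw [g₀]
      simp only [g₁]
      simp only [currentPairing, add_apply, smul_apply,
        smul_eq_mul, Fin.sum_univ_three, Pi.mul_apply, hcomm] at hwave ⊢
      change timeDeriv χ p * energyDensity u p - _ = χ p * _ + energyDensity u p * timeDeriv χ p - _
      simp only [← spaceDeriv.eq_1] at hwave ⊢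
      linear_combination (-(χ p * timeDeriv u p)) * hwave
    · rw [currentPairing_eq_zero_of_notMem_tsupport u hp]
      have h0 := notMem_tsupport_iff_eventuallyEq.1 hp
      have z : ∀ P : Spacetime → ℝ, fderiv ℝ (fun q => χ q * P q) p = 0 := fun P => by
        have : (fun q => χ q * P q) =ᶠ[𝓝 p] fun _ => 0 := by
          filter_upwards [h0] with q hq
          simp [hq]
        rw [this.fderiv_eq]
        simp
      simp [hW₀, hW, z]
  have hcont : ∀ {V : Spacetime → ℝ} (_ : ContDiff ℝ 1 V) (v : Spacetime),
      Continuous fun p => fderiv ℝ V p v := fun hV v =>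
    (hV.continuous_fderiv (by simp)).clm_apply continuous_const
  have hInt : ∀ {V : Spacetime → ℝ} (_ : ContDiff ℝ 1 V) (_ : HasCompactSupport V)
      (v : Spacetime), Integrable fun p => fderiv ℝ V p v := fun hV hK v =>
    (hcont hV v).integrable_of_hasCompactSupport (hK.fderiv_apply (𝕜 := ℝ) v)
  rw [hpair]
  refine ⟨(hcont c₀ _).sub (continuous_finsetSum _ fun i _ => hcont (c i) _), ?_⟩
  rw [integral_sub (hInt c₀ k₀ _) (integrable_finsetSum _ fun i _ => hInt (c i) (k i) _),
    integral_finsetSum _ fun i _ => hInt (c i) (k i) _, integral_fderiv_apply_eq_zero c₀ k₀]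
  simp [integral_fderiv_apply_eq_zero (c _) (k _)]

theorem hasFDerivAt_norm_of_ne_zero {x : EuclideanSpace ℝ (Fin 3)} (hx : x ≠ 0) :
    HasFDerivAt (fun y : EuclideanSpace ℝ (Fin 3) => ‖y‖) (‖x‖⁻¹ • innerSL ℝ x) x := by
  have hpos : ‖x‖ ≠ 0 := norm_ne_zero_iff.2 hx
  have h := (hasStrictFDerivAt_norm_sq x).hasFDerivAt.sqrt (pow_ne_zero 2 hpos)
  refine (h.congr_fderiv ?_).congr_of_eventuallyEq (Eventually.of_forall fun y => ?_)
  · ext v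
    simp only [Real.sqrt_sq (norm_nonneg x), smul_apply, smul_eq_mul]
    simp
    field_simp
  · simp [Real.sqrt_sq (norm_nonneg y)]

/-- The radial derivative `∂ᵣu`. -/
noncomputable def radialDeriv (u : Spacetime → ℝ) (p : Spacetime) : ℝ :=
  ∑ i, p.1 i / ‖p.1‖ * spaceDeriv u i p

/-- The energy density `|∇u + (x / |x|) ∂ₜu|² / 2` of the derivatives tangential to the cones
`t - |x| = const`. -/
noncomputable def coneEnergy (u : Spacetime → ℝ) (p : Spacetime) : ℝ :=
  (∑ i, (spaceDeriv u i p + p.1 i / ‖p.1‖ * timeDeriv u p) ^ 2) / 2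

/-- The weight `f(t) G(|x|) H(t - |x|)`. -/
noncomputable def coneCutoff (f G H : ℝ → ℝ) (p : Spacetime) : ℝ :=
  f p.2 * G ‖p.1‖ * H (p.2 - ‖p.1‖)

theorem energyDensity_nonneg (u : Spacetime → ℝ) (p : Spacetime) : 0 ≤ energyDensity u p := by
  unfold energyDensity; positivity

theorem coneEnergy_nonneg (u : Spacetime → ℝ) (p : Spacetime) : 0 ≤ coneEnergy u p := by
  unfold coneEnergy; positivity

theorem timeDeriv_eq_zero_of_energyDensity_eq_zero {u : Spacetime → ℝ} {p : Spacetime}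
    (h : energyDensity u p = 0) : timeDeriv u p = 0 := by
  have h1 : 0 ≤ ∑ i, spaceDeriv u i p ^ 2 := by positivity
  rw [energyDensity] at h
  nlinarith [sq_nonneg (timeDeriv u p)]

theorem sum_coord_div_norm_sq {x : EuclideanSpace ℝ (Fin 3)} (hx : x ≠ 0) :
    ∑ i, (x i / ‖x‖) ^ 2 = 1 := by
  have hpos : ‖x‖ ≠ 0 := norm_ne_zero_iff.2 hx
  simp only [div_pow, ← Finset.sum_div]
  rw [← EuclideanSpace.real_norm_sq_eq]
  exact div_self (pow_ne_zero 2 hpos)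

theorem coneEnergy_eq {u : Spacetime → ℝ} {p : Spacetime} (hp : p.1 ≠ 0) :
    coneEnergy u p = energyDensity u p + timeDeriv u p * radialDeriv u p := by
  have h := sum_coord_div_norm_sq hp
  simp only [coneEnergy, energyDensity, radialDeriv, Fin.sum_univ_three] at h ⊢
  linear_combination (timeDeriv u p ^ 2 / 2) * h

theorem contDiffAt_coneCutoff {f G H : ℝ → ℝ} (hf : ContDiff ℝ 1 f) (hG : ContDiff ℝ 1 G)
    (hH : ContDiff ℝ 1 H) {p : Spacetime} (hp : p.1 ≠ 0) :
    ContDiffAt ℝ 1 (coneCutoff f G H) p := by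
  have hn : ContDiffAt ℝ 1 (fun q : Spacetime => ‖q.1‖) p := contDiffAt_fst.norm ℝ hp
  exact ((hf.contDiffAt.comp p contDiffAt_snd).mul (hG.contDiffAt.comp p hn)).mul
    (hH.contDiffAt.comp p (contDiffAt_snd.sub hn))

theorem currentPairing_coneCutoff {f G H : ℝ → ℝ} (hf : ContDiff ℝ 1 f) (hG : ContDiff ℝ 1 G)
    (hH : ContDiff ℝ 1 H) (u : Spacetime → ℝ) {p : Spacetime} (hp : p.1 ≠ 0) :
    currentPairing (coneCutoff f G H) u p =
      deriv f p.2 * G ‖p.1‖ * H (p.2 - ‖p.1‖) * energyDensity u p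
      + f p.2 * G ‖p.1‖ * deriv H (p.2 - ‖p.1‖) * coneEnergy u p
      - f p.2 * deriv G ‖p.1‖ * H (p.2 - ‖p.1‖) * (timeDeriv u p * radialDeriv u p) := by
  have hd : ∀ {g : ℝ → ℝ} (_ : ContDiff ℝ 1 g) (s : ℝ), HasDerivAt g (deriv g s) s :=
    fun hg s => ((hg.differentiable (by simp)) s).hasDerivAt
  have hn : HasFDerivAt (fun q : Spacetime => ‖q.1‖)
      ((‖p.1‖⁻¹ • innerSL ℝ p.1).comp (ContinuousLinearMap.fst ℝ _ ℝ)) p :=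
    (hasFDerivAt_norm_of_ne_zero hp).comp p hasFDerivAt_fst
  have ht : HasFDerivAt (fun q : Spacetime => q.2) (ContinuousLinearMap.snd ℝ _ ℝ) p :=
    hasFDerivAt_snd
  have h : HasFDerivAt (coneCutoff f G H) _ p :=
    (((hd hf p.2).comp_hasFDerivAt p ht).mul ((hd hG ‖p.1‖).comp_hasFDerivAt p hn)).mul
      ((hd hH (p.2 - ‖p.1‖)).comp_hasFDerivAt p (ht.sub hn))
  have hT : timeDeriv (coneCutoff f G H) p = deriv f p.2 * G ‖p.1‖ * H (p.2 - ‖p.1‖)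
      + f p.2 * G ‖p.1‖ * deriv H (p.2 - ‖p.1‖) := by
    rw [timeDeriv, h.fderiv]
    simp
    ring
  have hX : ∀ i, spaceDeriv (coneCutoff f G H) i p =
      (f p.2 * deriv G ‖p.1‖ * H (p.2 - ‖p.1‖)
        - f p.2 * G ‖p.1‖ * deriv H (p.2 - ‖p.1‖)) * (p.1 i / ‖p.1‖) := fun i => by
    rw [spaceDeriv, h.fderiv]
    simp [EuclideanSpace.inner_single_right]
    ring
  rw [coneEnergy_eq hp, currentPairing, hT]
  simp only [hX, radialDeriv, Fin.sum_univ_three]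
  ring

theorem eq_zero_of_tendsto_of_integral_eq_zero {Ω : Set Spacetime} (hΩ : IsOpen Ω)
    {F : ℕ → Spacetime → ℝ} {Φ : Spacetime → ℝ} {C R : ℝ} (hc : ∀ n, Continuous (F n))
    (hi : ∀ n, ∫ p, F n p = 0)
    (hb : ∀ n p, |F n p| ≤ (Metric.closedBall 0 R).indicator (fun _ => C) p)
    (hl : ∀ p, Tendsto (fun n => F n p) atTop (𝓝 (Φ p))) (hnn : ∀ p, 0 ≤ Φ p)
    (hΦ : ContinuousOn Φ Ω) : ∀ p ∈ Ω, Φ p = 0 := by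
  have hbound : Integrable ((Metric.closedBall (0 : Spacetime) R).indicator fun _ => C) :=
    (integrable_indicator_iff Metric.isClosed_closedBall.measurableSet).2
      (integrableOn_const (isCompact_closedBall _ _).measure_lt_top.ne)
  have hmeas : AEStronglyMeasurable Φ :=
    aestronglyMeasurable_of_tendsto_ae atTop (fun n => (hc n).aestronglyMeasurable)
      (Eventually.of_forall hl)
  have hInt : Integrable Φ := hbound.mono' hmeas <| Eventually.of_forall fun p =>
    le_of_tendsto (hl p).norm (Eventually.of_forall fun n => hb n p)
  have hlim := tendsto_integral_of_dominated_convergence _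
    (fun n => (hc n).aestronglyMeasurable (μ := (volume : Measure Spacetime))) hbound
    (fun n => Eventually.of_forall (hb n)) (Eventually.of_forall hl)
  have hzero : ∫ p, Φ p = 0 := by
    simp only [hi] at hlim
    exact tendsto_nhds_unique hlim tendsto_const_nhds
  have hae : Φ =ᵐ[volume] 0 := (integral_eq_zero_iff_of_nonneg hnn hInt).1 hzero
  have := Measure.eqOn_open_of_ae_eq (ae_restrict_of_ae hae) hΩ hΦ continuousOn_const
  exact fun p hp => this hp

theorem exists_bound_fderivWithin {E : Type*} [NormedAddCommGroup E] [NormedSpace ℝ E]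
    {S K : Set E} {α : E → ℝ} (hS : UniqueDiffOn ℝ S) (hα : ContDiffOn ℝ 2 α S)
    (hK : IsCompact K) (hKS : K ⊆ S) :
    ∃ C, 0 ≤ C ∧ (∀ p ∈ K, ‖fderivWithin ℝ α S p‖ ≤ C) ∧ ∀ p q, segment ℝ p q ⊆ K →
      ‖fderivWithin ℝ α S q - fderivWithin ℝ α S p‖ ≤ C * ‖q - p‖ := by
  have h1 : ContDiffOn ℝ 1 (fderivWithin ℝ α S) S := hα.fderivWithin hS (by norm_num)
  obtain ⟨C₁, hC₁⟩ := hK.exists_bound_of_continuousOn (h1.continuousOn.mono hKS)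
  obtain ⟨C₂, hC₂⟩ := hK.exists_bound_of_continuousOn
    ((h1.continuousOn_fderivWithin hS (by simp)).mono hKS)
  refine ⟨max 0 (max C₁ C₂), le_max_left _ _, fun p hp => (hC₁ p hp).trans (by simp),
    fun p q hpq => ?_⟩
  refine (convex_segment p q).norm_image_sub_le_of_norm_hasFDerivWithin_le
    (f' := fderivWithin ℝ (fderivWithin ℝ α S) S) (fun y hy => ?_)
    (fun y hy => (hC₂ y (hpq hy)).trans (by simp)) (left_mem_segment ℝ p q)
    (right_mem_segment ℝ p q)
  exact ((h1.differentiableOn (by simp)) y (hKS (hpq hy))).hasFDerivWithinAt.mono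
    (hpq.trans hKS)

theorem fderivWithin_apply_eq_zero_of_curve {E : Type*} [NormedAddCommGroup E]
    [NormedSpace ℝ E] {S : Set E} {α : E → ℝ} {T : Set ℝ} {c : ℝ → E} {s : ℝ} {v : E}
    (hα : DifferentiableWithinAt ℝ α S (c s)) (hc : HasDerivWithinAt c v T s)
    (hT : UniqueDiffWithinAt ℝ T s) (hs : s ∈ T) (hmaps : MapsTo c T S)
    (h0 : ∀ r ∈ T, α (c r) = 0) : fderivWithin ℝ α S (c s) v = 0 := by
  have h1 := hα.hasFDerivWithinAt.comp_hasDerivWithinAt s hc hmaps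
  have h2 : HasDerivWithinAt (α ∘ c) 0 T s :=
    (hasDerivWithinAt_const s T (0 : ℝ)).congr (fun r hr => h0 r hr) (h0 s hs)
  exact hT.eq_deriv _ h1 h2

theorem abs_fderivWithin_time_le_near_wall {S K : Set Spacetime} {α : Spacetime → ℝ} {C a b : ℝ}
    (hα : DifferentiableOn ℝ α S)
    (hC : ∀ p q, segment ℝ p q ⊆ K →
      ‖fderivWithin ℝ α S q - fderivWithin ℝ α S p‖ ≤ C * ‖q - p‖)
    (hab : a < b) (hKt : ∀ p ∈ K, p.2 ∈ Icc a b) (hK1 : ∀ p ∈ K, 1 ≤ ‖p.1‖)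
    (hKseg : ∀ p ∈ K, ∀ c ∈ Icc ‖p.1‖⁻¹ 1, (c • p.1, p.2) ∈ K)
    (hwall : ∀ x : EuclideanSpace ℝ (Fin 3), ∀ t, ‖x‖ = 1 → t ∈ Icc a b →
      (x, t) ∈ S ∧ α (x, t) = 0) {p : Spacetime} (hp : p ∈ K) :
    |fderivWithin ℝ α S p (0, 1)| ≤ C * (‖p.1‖ - 1) := by
  have hr := hK1 p hp
  have hr0 : 0 < ‖p.1‖ := by linarith
  have hinv : ‖p.1‖⁻¹ ≤ 1 := inv_le_one_of_one_le₀ hr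
  set q : Spacetime := (‖p.1‖⁻¹ • p.1, p.2) with hq
  have hq1 : ‖q.1‖ = 1 := by
    simp only [hq, norm_smul, norm_inv, norm_norm]
    exact inv_mul_cancel₀ hr0.ne'
  have hseg : segment ℝ q p ⊆ K := by
    rintro z ⟨s, t, hs, ht, hst, rfl⟩
    have := hKseg p hp (s * ‖p.1‖⁻¹ + t) ⟨by nlinarith, by nlinarith⟩
    convert! this using 1
    ext1
    · simp [hq, add_smul, mul_smul]
    · simp [hq, ← add_mul, hst]
  have hdist : ‖p - q‖ = ‖p.1‖ - 1 := by
    have h1 : p - q = ((1 - ‖p.1‖⁻¹) • p.1, 0) := by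
      ext1
      · simp [hq, sub_smul]
      · simp [hq]
    rw [h1, Prod.norm_def]
    simp only [norm_smul, norm_zero, Real.norm_eq_abs, abs_of_nonneg (sub_nonneg.2 hinv)]
    rw [max_eq_left (by have := sub_nonneg.2 hinv; positivity), sub_mul,
      inv_mul_cancel₀ hr0.ne', one_mul]
  have hzero : fderivWithin ℝ α S q (0, 1) = 0 :=
    fderivWithin_apply_eq_zero_of_curve (T := Icc a b) (c := fun s => (q.1, s)) (s := p.2)
      (hα _ (hwall _ _ hq1 (hKt p hp)).1)
      ((hasDerivWithinAt_const _ _ _).prodMk (hasDerivWithinAt_id _ _))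
      (uniqueDiffOn_Icc hab _ (hKt p hp)) (hKt p hp) (fun s hs => (hwall _ _ hq1 hs).1)
      (fun s hs => (hwall _ _ hq1 hs).2)
  have h := (fderivWithin ℝ α S p - fderivWithin ℝ α S q).le_of_opNorm_le (hC q p hseg) (0, 1)
  rw [sub_apply, hzero, sub_zero, hdist] at h
  simpa using h

/-- The square of the positive part, a `C¹` function on `ℝ`. -/
noncomputable def posSq (s : ℝ) : ℝ := max s 0 ^ 2

theorem hasDerivAt_posSq (s : ℝ) : HasDerivAt posSq (2 * max s 0) s := by
  rcases lt_trichotomy s 0 with hs | rfl | hs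
  · rw [max_eq_right hs.le, mul_zero]
    refine (hasDerivAt_const s (0 : ℝ)).congr_of_eventuallyEq ?_
    filter_upwards [Iio_mem_nhds hs] with r hr
    simp [posSq, max_eq_right (mem_Iio.1 hr).le]
  · rw [hasDerivAt_iff_isLittleO_nhds_zero]
    have h : (fun h : ℝ => posSq (0 + h) - posSq 0 - h • (2 * max (0 : ℝ) 0))
        =O[𝓝 0] fun h => h ^ 2 := by
      refine Asymptotics.isBigO_of_le _ fun h => ?_
      simp only [posSq, zero_add, max_self, mul_zero, smul_zero, sub_zero, norm_pow,
        Real.norm_eq_abs]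
      simp only [ne_eq, OfNat.ofNat_ne_zero, not_false_eq_true, zero_pow, sub_zero, abs_pow]
      rw [abs_of_nonneg (le_max_right h 0)]
      exact pow_le_pow_left₀ (le_max_right h 0) (max_le (le_abs_self h) (abs_nonneg h)) 2
    exact h.trans_isLittleO (by simpa using Asymptotics.isLittleO_pow_id (𝕜 := ℝ) one_lt_two)
  · rw [max_eq_left hs.le]
    refine (by simpa using hasDerivAt_pow 2 s : HasDerivAt (fun r : ℝ => r ^ 2) (2 * s) s)
      |>.congr_of_eventuallyEq ?_
    filter_upwards [Ioi_mem_nhds hs] with r hr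
    simp [posSq, max_eq_left (mem_Ioi.1 hr).le]

theorem contDiff_posSq : ContDiff ℝ 1 posSq := by
  have h : deriv posSq = fun s => 2 * max s 0 := funext fun s => (hasDerivAt_posSq s).deriv
  refine contDiff_one_iff_deriv.2 ⟨fun s => (hasDerivAt_posSq s).differentiableAt, ?_⟩
  rw [h]
  fun_prop

theorem posSq_of_nonpos {s : ℝ} (hs : s ≤ 0) : posSq s = 0 := by
  simp [posSq, max_eq_right hs]

/-- A `C¹` weight in time supported in `|t - 1| ≤ a` and with its maximum at `t = 1`. -/
noncomputable def timeWeight (a t : ℝ) : ℝ := posSq (a ^ 2 - (t - 1) ^ 2)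

theorem contDiff_timeWeight (a : ℝ) : ContDiff ℝ 1 (timeWeight a) :=
  contDiff_posSq.comp (by fun_prop)

theorem deriv_timeWeight (a t : ℝ) :
    deriv (timeWeight a) t = 4 * max (a ^ 2 - (t - 1) ^ 2) 0 * (1 - t) := by
  have h : HasDerivAt (fun t : ℝ => a ^ 2 - (t - 1) ^ 2) (-(2 * (t - 1))) t := by
    simpa using (((hasDerivAt_id t).sub_const 1).pow 2).const_sub (a ^ 2)
  have : HasDerivAt (timeWeight a) _ t := (hasDerivAt_posSq _).comp t h
  rw [this.deriv]
  ring

/-- Smooth steps on the scale `1 / (n + 1)`. -/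
noncomputable def steepStep (n : ℕ) (s : ℝ) : ℝ := Real.smoothTransition ((n + 1) * s - 1)

theorem contDiff_steepStep (n : ℕ) : ContDiff ℝ 1 (steepStep n) :=
  (Real.smoothTransition.contDiff (n := 1)).comp (by fun_prop)

theorem abs_steepStep_le_one (n : ℕ) (s : ℝ) : |steepStep n s| ≤ 1 := by
  rw [steepStep, abs_of_nonneg (Real.smoothTransition.nonneg _)]
  exact Real.smoothTransition.le_one _

theorem le_of_steepStep_ne_zero {n : ℕ} {s : ℝ} (h : steepStep n s ≠ 0) :
    1 / ((n : ℝ) + 1) ≤ s := by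
  by_contra! hs
  rw [lt_div_iff₀ (by positivity)] at hs
  exact h (Real.smoothTransition.zero_of_nonpos (by linarith))

theorem deriv_steepStep (n : ℕ) (s : ℝ) :
    deriv (steepStep n) s = (n + 1) * deriv Real.smoothTransition ((n + 1) * s - 1) := by
  have h : HasDerivAt (fun s : ℝ => ((n : ℝ) + 1) * s - 1) ((n : ℝ) + 1) s := by
    simpa using ((hasDerivAt_id s).const_mul ((n : ℝ) + 1)).sub_const 1
  have hd : HasDerivAt Real.smoothTransition _ (((n : ℝ) + 1) * s - 1) :=
    (((Real.smoothTransition.contDiff (n := 1)).differentiable (by simp)) _).hasDerivAt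
  have : HasDerivAt (steepStep n) _ s := hd.comp s h
  rw [this.deriv, mul_comm]

theorem deriv_smoothTransition_of_notMem {y : ℝ} (hy : y ∉ Icc (0 : ℝ) 1) :
    deriv Real.smoothTransition y = 0 := by
  rw [mem_Icc, not_and_or, not_le, not_le] at hy
  rcases hy with hy | hy
  · have : Real.smoothTransition =ᶠ[𝓝 y] fun _ => 0 := by
      filter_upwards [Iio_mem_nhds hy] with z hz
      exact Real.smoothTransition.zero_of_nonpos (mem_Iio.1 hz).le
    rw [this.deriv_eq, deriv_const]
  · have : Real.smoothTransition =ᶠ[𝓝 y] fun _ => 1 := by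
      filter_upwards [Ioi_mem_nhds hy] with z hz
      exact Real.smoothTransition.one_of_one_le (mem_Ioi.1 hz).le
    rw [this.deriv_eq, deriv_const]

theorem exists_abs_deriv_steepStep_mul_le :
    ∃ M, 0 ≤ M ∧ ∀ n s, 0 ≤ s → |deriv (steepStep n) s| * s ≤ M := by
  have hc : Continuous fun y : ℝ => deriv Real.smoothTransition y * (y + 1) :=
    ((Real.smoothTransition.contDiff (n := 1)).continuous_deriv (by simp)).mul (by fun_prop)
  obtain ⟨M, hM⟩ := (isCompact_Icc (a := (0 : ℝ)) (b := 1)).exists_bound_of_continuousOn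
    hc.continuousOn
  refine ⟨max M 0, le_max_right _ _, fun n s hs => ?_⟩
  have h : |deriv (steepStep n) s| * s = ‖deriv Real.smoothTransition ((n + 1) * s - 1) *
      ((n + 1) * s - 1 + 1)‖ := by
    rw [deriv_steepStep, Real.norm_eq_abs, sub_add_cancel, abs_mul, abs_mul, abs_mul,
      abs_of_nonneg hs]
    ring
  rw [h]
  by_cases hy : ((n : ℝ) + 1) * s - 1 ∈ Icc (0 : ℝ) 1
  · exact (hM _ hy).trans (le_max_left _ _)
  · rw [deriv_smoothTransition_of_notMem hy, zero_mul, norm_zero]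
    exact le_max_right _ _

theorem eventually_steepStep_eq_one {s : ℝ} (hs : 0 < s) :
    ∀ᶠ n in atTop, steepStep n s = 1 ∧ deriv (steepStep n) s = 0 := by
  have ht : Tendsto (fun n : ℕ => ((n : ℝ) + 1) * s - 1) atTop atTop :=
    tendsto_atTop_add_const_right _ _
      ((tendsto_atTop_add_const_right _ _ tendsto_natCast_atTop_atTop).atTop_mul_const hs)
  filter_upwards [ht.eventually_gt_atTop 1] with n hn
  refine ⟨Real.smoothTransition.one_of_one_le hn.le, ?_⟩
  rw [deriv_steepStep, deriv_smoothTransition_of_notMem fun h => absurd h.2 (not_le.2 hn),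
    mul_zero]

theorem abs_timeDeriv_le {u : Spacetime → ℝ} {p : Spacetime} {C : ℝ} (h : ‖fderiv ℝ u p‖ ≤ C) :
    |timeDeriv u p| ≤ C := by
  simpa [timeDeriv] using (fderiv ℝ u p).le_of_opNorm_le h (0, 1)

theorem abs_spaceDeriv_le {u : Spacetime → ℝ} {p : Spacetime} {C : ℝ}
    (h : ‖fderiv ℝ u p‖ ≤ C) (i : Fin 3) : |spaceDeriv u i p| ≤ C := by
  simpa [spaceDeriv] using (fderiv ℝ u p).le_of_opNorm_le h (EuclideanSpace.single i 1, 0)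

theorem abs_coord_div_norm_le_one (x : EuclideanSpace ℝ (Fin 3)) (i : Fin 3) :
    |x i / ‖x‖| ≤ 1 := by
  rw [abs_div, abs_norm]
  exact div_le_one_of_le₀ (PiLp.norm_apply_le x i) (norm_nonneg x)

theorem energyDensity_le {u : Spacetime → ℝ} {p : Spacetime} {C : ℝ} (h : ‖fderiv ℝ u p‖ ≤ C) :
    energyDensity u p ≤ 2 * C ^ 2 := by
  have h0 := sq_le_sq' (abs_le.1 (abs_timeDeriv_le h)).1 (abs_le.1 (abs_timeDeriv_le h)).2
  have h1 := fun i => sq_le_sq' (abs_le.1 (abs_spaceDeriv_le h i)).1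
    (abs_le.1 (abs_spaceDeriv_le h i)).2
  rw [energyDensity, Fin.sum_univ_three]
  linarith [h1 0, h1 1, h1 2]

theorem abs_radialDeriv_le {u : Spacetime → ℝ} {p : Spacetime} {C : ℝ}
    (h : ‖fderiv ℝ u p‖ ≤ C) : |radialDeriv u p| ≤ 3 * C := by
  have h1 : ∀ i, |p.1 i / ‖p.1‖ * spaceDeriv u i p| ≤ C := fun i => by
    rw [abs_mul]
    calc |p.1 i / ‖p.1‖| * |spaceDeriv u i p| ≤ 1 * C :=
          mul_le_mul (abs_coord_div_norm_le_one _ _) (abs_spaceDeriv_le h i) (abs_nonneg _)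
            zero_le_one
      _ = C := one_mul C
  rw [radialDeriv]
  refine (Finset.abs_sum_le_sum_abs _ _).trans ?_
  rw [Fin.sum_univ_three]
  linarith [h1 0, h1 1, h1 2]

theorem coneEnergy_le_of_abs_le {u : Spacetime → ℝ} {p : Spacetime} {C : ℝ}
    (h : ∀ i, |spaceDeriv u i p + p.1 i / ‖p.1‖ * timeDeriv u p| ≤ C) :
    coneEnergy u p ≤ 2 * C ^ 2 := by
  have h1 := fun i => sq_le_sq' (abs_le.1 (h i)).1 (abs_le.1 (h i)).2
  rw [coneEnergy, Fin.sum_univ_three]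
  linarith [h1 0, h1 1, h1 2, sq_nonneg C]

theorem continuousOn_energyDensity {Ω : Set Spacetime} (hΩ : IsOpen Ω) {u : Spacetime → ℝ}
    (hu : ContDiffOn ℝ 2 u Ω) : ContinuousOn (energyDensity u) Ω := by
  have hD : ContinuousOn (fderiv ℝ u) Ω := hu.continuousOn_fderiv_of_isOpen hΩ (by simp)
  unfold energyDensity timeDeriv spaceDeriv
  fun_prop

theorem continuousOn_coneEnergy {Ω : Set Spacetime} (hΩ : IsOpen Ω) {u : Spacetime → ℝ}
    (hu : ContDiffOn ℝ 2 u Ω) (h0 : ∀ p ∈ Ω, p.1 ≠ 0) : ContinuousOn (coneEnergy u) Ω := by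
  have hD : ContinuousOn (fderiv ℝ u) Ω := hu.continuousOn_fderiv_of_isOpen hΩ (by simp)
  have h1 : ∀ p ∈ Ω, ‖p.1‖ ≠ 0 := fun p hp => norm_ne_zero_iff.2 (h0 p hp)
  unfold coneEnergy timeDeriv spaceDeriv
  fun_prop (disch := assumption)

theorem eq_of_timeDeriv_eq_zero {u : Spacetime → ℝ} {x : EuclideanSpace ℝ (Fin 3)} {a b : ℝ}
    (hab : a < b) (hc : ContinuousOn (fun s : ℝ => u (x, s)) (Icc a b))
    (hd : ∀ s ∈ Ioo a b, DifferentiableAt ℝ u (x, s))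
    (h0 : ∀ s ∈ Ioo a b, timeDeriv u (x, s) = 0) : u (x, a) = u (x, b) := by
  obtain ⟨s, hs, hs'⟩ := exists_hasDerivAt_eq_slope (fun s : ℝ => u (x, s))
    (fun s => timeDeriv u (x, s)) hab hc fun s hs =>
      (hd s hs).hasFDerivAt.comp_hasDerivAt s ((hasDerivAt_const s x).prodMk (hasDerivAt_id s))
  rw [h0 s hs, eq_comm, div_eq_zero_iff] at hs'
  rcases hs' with h | h <;> linarith

theorem uniqueDiffOn_above_cone : UniqueDiffOn ℝ
    {p : Spacetime | p.1 ≠ 0 ∧ -‖p.1‖ < p.2 ∧ ‖p.1‖ ≤ p.2} := by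
  have hconv : Convex ℝ {p : Spacetime | ‖p.1‖ ≤ p.2} := by
    have h : ConvexOn ℝ univ fun p : Spacetime => ‖p.1‖ - p.2 :=
      ((convexOn_univ_norm (E := EuclideanSpace ℝ (Fin 3))).comp_linearMap
        (LinearMap.fst ℝ _ ℝ)).sub ((LinearMap.snd ℝ _ ℝ).concaveOn convex_univ)
    simpa using h.convex_le 0
  have hInt : (interior {p : Spacetime | ‖p.1‖ ≤ p.2}).Nonempty := by
    refine ⟨(0, 1), mem_interior.2 ⟨{p : Spacetime | ‖p.1‖ < p.2}, fun p hp => LT.lt.le (a := ‖p.1‖) (b := p.2) hp,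
      isOpen_lt (by fun_prop) (by fun_prop), by simp⟩⟩
  have hopen : IsOpen {p : Spacetime | p.1 ≠ 0 ∧ -‖p.1‖ < p.2} :=
    (isOpen_ne_fun continuous_fst continuous_const).inter
      (isOpen_lt continuous_fst.norm.neg continuous_snd)
  convert! (uniqueDiffOn_convex hconv hInt).inter hopen using 1
  ext p
  simp only [mem_ofPred_eq, mem_inter_iff]
  tauto

theorem uniqueDiffOn_below_cone : UniqueDiffOn ℝ
    {p : Spacetime | p.1 ≠ 0 ∧ -‖p.1‖ < p.2 ∧ p.2 ≤ ‖p.1‖} := by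
  rintro p ⟨hp0, hp1, hp2⟩
  have hpos : 0 < ‖p.1‖ := norm_pos_iff.2 hp0
  set A : Set Spacetime := {q | q.2 * ‖p.1‖ ≤ inner ℝ p.1 q.1} with hA
  have hconv : Convex ℝ A := by
    intro q hq r hr a b ha hb _
    simp only [hA, mem_ofPred_eq, Prod.snd_add, Prod.smul_snd, smul_eq_mul, Prod.fst_add,
      Prod.smul_fst, inner_add_right, inner_smul_right] at hq hr ⊢
    nlinarith [mul_le_mul_of_nonneg_left hq ha, mul_le_mul_of_nonneg_left hr hb]
  have hInt : (interior A).Nonempty := by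
    refine ⟨(0, -1), mem_interior.2 ⟨{q : Spacetime | q.2 * ‖p.1‖ < inner ℝ p.1 q.1},
      fun q hq => LT.lt.le (a := q.2 * ‖p.1‖) (b := inner ℝ p.1 q.1) hq, isOpen_lt (by fun_prop) (by fun_prop), by simpa using hpos⟩⟩
  have hopen : IsOpen {p : Spacetime | p.1 ≠ 0 ∧ -‖p.1‖ < p.2} :=
    (isOpen_ne_fun continuous_fst continuous_const).inter
      (isOpen_lt continuous_fst.norm.neg continuous_snd)
  have hpA : p ∈ A := by
    simp only [hA, mem_ofPred_eq, real_inner_self_eq_norm_sq]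
    nlinarith
  refine ((uniqueDiffOn_convex hconv hInt).inter hopen p ⟨hpA, hp0, hp1⟩).mono ?_
  rintro q ⟨hq, hq0, hq1⟩
  refine ⟨hq0, hq1, ?_⟩
  have := real_inner_le_norm p.1 q.1
  have hq' : q.2 * ‖p.1‖ ≤ inner ℝ p.1 q.1 := hq
  nlinarith

theorem contDiff_wallStep (n : ℕ) : ContDiff ℝ 1 fun r => steepStep n (r - 1) :=
  (contDiff_steepStep n).comp (by fun_prop)

theorem abs_weighted_current_le {f f' G G' H H' e q m r B L X Y Z : ℝ} (hf : |f| ≤ B)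
    (hf' : |f'| ≤ B) (hG : |G| ≤ 1) (hH : |H| ≤ L) (he : 0 ≤ e) (heX : e ≤ X) (hq : 0 ≤ q)
    (hqY : |H'| * q ≤ Y) (hm : |G'| * |m| ≤ Z) (hr : |r| ≤ X) :
    |f' * G * H * e + f * G * H' * q - f * G' * H * (m * r)| ≤
      B * L * X + B * Y + B * L * (Z * X) := by
  have hB : 0 ≤ B := (abs_nonneg f).trans hf
  have hL : 0 ≤ L := (abs_nonneg H).trans hH
  have h1 : |f' * G * H * e| ≤ B * L * X := by
    rw [abs_mul, abs_mul, abs_mul, abs_of_nonneg he]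
    calc |f'| * |G| * |H| * e ≤ B * 1 * L * X := by gcongr
      _ = _ := by ring
  have h2 : |f * G * H' * q| ≤ B * Y := by
    rw [abs_mul, abs_mul, abs_mul, abs_of_nonneg hq]
    calc |f| * |G| * |H'| * q = |f| * |G| * (|H'| * q) := by ring
      _ ≤ B * 1 * Y := by gcongr
      _ = _ := by ring
  have h3 : |f * G' * H * (m * r)| ≤ B * L * (Z * X) := by
    rw [abs_mul, abs_mul, abs_mul, abs_mul]
    have hZ : 0 ≤ Z := le_trans (by positivity) hm
    calc |f| * |G'| * |H| * (|m| * |r|) = |f| * |H| * ((|G'| * |m|) * |r|) := by ring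
      _ ≤ B * L * (Z * X) := by gcongr
  calc _ ≤ |f' * G * H * e + f * G * H' * q| + |f * G' * H * (m * r)| := abs_sub _ _
    _ ≤ |f' * G * H * e| + |f * G * H' * q| + |f * G' * H * (m * r)| := by
      gcongr; exact abs_add_le _ _
    _ ≤ _ := by gcongr

theorem exists_bounds_above_cone {α : Spacetime → ℝ}
    (hsm : ContDiffOn ℝ 2 α {p : Spacetime | p.1 ≠ 0 ∧ -‖p.1‖ < p.2 ∧ ‖p.1‖ ≤ p.2})
    (hcone : ∀ (x : EuclideanSpace ℝ (Fin 3)) (t : ℝ), 1 ≤ t → t ≤ ‖x‖ → α (x, t) = 0)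
    (hbdry : ∀ (x : EuclideanSpace ℝ (Fin 3)) (t : ℝ), ‖x‖ = 1 → -1 < t → t ≤ 3 →
      α (x, t) = 0) :
    ∃ C, 0 ≤ C ∧ ∀ p : Spacetime, 1 < ‖p.1‖ → ‖p.1‖ < p.2 → p.2 ≤ 3 →
      ‖fderiv ℝ α p‖ ≤ C ∧ |timeDeriv α p| ≤ C * (‖p.1‖ - 1) ∧
      ∀ i, |spaceDeriv α i p + p.1 i / ‖p.1‖ * timeDeriv α p| ≤ C * (p.2 - ‖p.1‖) := by
  set S : Set Spacetime := {p | p.1 ≠ 0 ∧ -‖p.1‖ < p.2 ∧ ‖p.1‖ ≤ p.2} with hS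
  set K : Set Spacetime := {p | 1 ≤ ‖p.1‖ ∧ ‖p.1‖ ≤ p.2 ∧ p.2 ≤ 3} with hK
  have hSmem : ∀ p : Spacetime, 1 ≤ ‖p.1‖ → ‖p.1‖ ≤ p.2 → p ∈ S := fun p h1 h2 =>
    ⟨norm_pos_iff.1 (by linarith), by linarith, h2⟩
  have hKS : K ⊆ S := fun p hp => hSmem p hp.1 hp.2.1
  have hKc : IsCompact K := by
    refine Metric.isCompact_of_isClosed_isBounded ?_ ?_
    · exact (isClosed_le continuous_const continuous_fst.norm).inter
        ((isClosed_le continuous_fst.norm continuous_snd).inter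
          (isClosed_le continuous_snd continuous_const))
    · refine (Metric.isBounded_closedBall (x := (0 : Spacetime)) (r := 3)).subset ?_
      rintro p ⟨h1, h2, h3⟩
      rw [mem_closedBall_zero_iff, Prod.norm_def, max_le_iff, Real.norm_eq_abs, abs_le]
      exact ⟨by linarith, by linarith, h3⟩
  obtain ⟨C, hC0, hC1, hC2⟩ := exists_bound_fderivWithin uniqueDiffOn_above_cone hsm hKc hKS
  have hdiff : DifferentiableOn ℝ α S := hsm.differentiableOn (by simp)
  refine ⟨C, hC0, fun p h1 h2 h3 => ?_⟩
  have hpK : p ∈ K := ⟨h1.le, h2.le, h3⟩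
  have hr0 : 0 < ‖p.1‖ := by linarith
  have hp0 : p.1 ≠ 0 := norm_pos_iff.1 hr0
  have hnhds : S ∈ 𝓝 p := by
    have : {q : Spacetime | 1 < ‖q.1‖} ∩ {q : Spacetime | ‖q.1‖ < q.2} ∈ 𝓝 p :=
      ((isOpen_lt continuous_const continuous_fst.norm).inter
        (isOpen_lt continuous_fst.norm continuous_snd)).mem_nhds ⟨h1, h2⟩
    filter_upwards [this] with q hq
    exact hSmem q (LT.lt.le hq.1) (LT.lt.le hq.2)
  have hfd : fderivWithin ℝ α S p = fderiv ℝ α p := fderivWithin_of_mem_nhds hnhds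
  refine ⟨hfd ▸ hC1 p hpK, ?_, fun i => ?_⟩
  · rw [timeDeriv, ← hfd]
    refine abs_fderivWithin_time_le_near_wall hdiff hC2 (a := 1) (b := 3) (by norm_num)
      (fun q hq => ⟨hq.1.trans hq.2.1, hq.2.2⟩) (fun q hq => hq.1) ?_
      (fun x t hx ht => ⟨hSmem _ hx.ge (hx.trans_le ht.1),
        hbdry x t hx (by linarith [ht.1]) ht.2⟩) hpK
    rintro q ⟨hq1, hq2, hq3⟩ c ⟨hc1, hc2⟩
    have hq0 : 0 < ‖q.1‖ := by linarith
    have hc0 : 0 < c := (inv_pos.2 hq0).trans_le hc1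
    have hn : ‖c • q.1‖ = c * ‖q.1‖ := by rw [norm_smul, Real.norm_eq_abs, abs_of_pos hc0]
    refine ⟨?_, ?_, hq3⟩
    · rw [hn]
      rwa [inv_le_iff_one_le_mul₀ hq0] at hc1
    · rw [hn]
      nlinarith
  · set q : Spacetime := (p.1, ‖p.1‖) with hq
    have hseg : segment ℝ q p ⊆ K := by
      rintro z ⟨a, b, ha, hb, hab, rfl⟩
      have e1 : (a • q + b • p).1 = p.1 := by
        simp [hq, ← add_smul, hab]
      have e2 : (a • q + b • p).2 = a * ‖p.1‖ + b * p.2 := by simp [hq]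
      have hb' : b = 1 - a := by linarith
      refine ⟨by rw [e1]; exact h1.le, ?_, ?_⟩
      · rw [e1, e2, hb']; nlinarith
      · rw [e2, hb']; nlinarith
    have hdist : ‖p - q‖ = p.2 - ‖p.1‖ := by
      have e : p - q = (0, p.2 - ‖p.1‖) := by
        ext1 <;> simp [hq]
      rw [e, Prod.norm_def, norm_zero, Real.norm_eq_abs, abs_of_pos (by linarith)]
      exact max_eq_right (by linarith)
    set v : Spacetime := (EuclideanSpace.single i 1, p.1 i / ‖p.1‖) with hv
    have hvn : ‖v‖ ≤ 1 := by
      rw [hv, Prod.norm_def, max_le_iff]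
      exact ⟨by simp, abs_coord_div_norm_le_one _ _⟩
    set ℓ : ℝ → EuclideanSpace ℝ (Fin 3) := fun s => p.1 + s • EuclideanSpace.single i 1 with hℓ
    have hℓd : HasDerivAt ℓ (EuclideanSpace.single i 1) 0 :=
      (((hasDerivAt_id (0 : ℝ)).smul_const (EuclideanSpace.single i (1 : ℝ))).const_add
        p.1).congr_deriv (one_smul ℝ _)
    have hℓc : Continuous ℓ := by fun_prop
    have hℓ0 : ℓ 0 = p.1 := by simp [hℓ]
    have hTopen : IsOpen {s : ℝ | 1 < ‖ℓ s‖} := isOpen_lt continuous_const hℓc.norm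
    have hT0 : (0 : ℝ) ∈ {s : ℝ | 1 < ‖ℓ s‖} := by
      change 1 < ‖ℓ 0‖
      rwa [hℓ0]
    have hnd : HasDerivAt (fun s => ‖ℓ s‖) (p.1 i / ‖p.1‖) 0 := by
      have h := (hasFDerivAt_norm_of_ne_zero (x := ℓ 0) (hℓ0 ▸ hp0)).comp_hasDerivAt (0 : ℝ) hℓd
      refine h.congr_deriv ?_
      rw [hℓ0]
      simp [EuclideanSpace.inner_single_right]
      ring
    have hc0 : (ℓ 0, ‖ℓ 0‖) = q := by rw [hℓ0]
    have hzero : fderivWithin ℝ α S q v = 0 := by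
      rw [← hc0]
      refine fderivWithin_apply_eq_zero_of_curve (T := {s : ℝ | 1 < ‖ℓ s‖})
        (c := fun s => (ℓ s, ‖ℓ s‖)) (s := 0) (hdiff _ ?_)
        (hℓd.prodMk hnd).hasDerivWithinAt (hTopen.uniqueDiffWithinAt hT0) hT0
        (fun s hs => hSmem _ (LT.lt.le hs) le_rfl)
        (fun s hs => hcone _ _ (LT.lt.le hs) le_rfl)
      exact hSmem _ (LT.lt.le hT0) le_rfl
    have h := (fderivWithin ℝ α S p - fderivWithin ℝ α S q).le_of_opNorm_le (hC2 q p hseg) v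
    rw [sub_apply, hzero, sub_zero, hdist, hfd, Real.norm_eq_abs] at h
    have hlin : fderiv ℝ α p v = spaceDeriv α i p + p.1 i / ‖p.1‖ * timeDeriv α p := by
      have e : v = (EuclideanSpace.single i 1, 0) + (p.1 i / ‖p.1‖) • ((0, 1) : Spacetime) := by
        ext1 <;> simp [hv]
      rw [e, map_add, map_smul, smul_eq_mul, spaceDeriv, timeDeriv]
    rw [← hlin]
    refine h.trans (mul_le_of_le_one_right ?_ hvn)
    exact mul_nonneg hC0 (by linarith)

/-- Uniqueness for the characteristic problem in `{|x| ≥ 1, |x| ≤ t ≤ 3}`. -/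
theorem eq_zero_above_cone {α : Spacetime → ℝ}
    (hsm : ContDiffOn ℝ 2 α {p : Spacetime | p.1 ≠ 0 ∧ -‖p.1‖ < p.2 ∧ ‖p.1‖ ≤ p.2})
    (hpde : ∀ p : Spacetime, 1 < ‖p.1‖ → ‖p.1‖ < p.2 → waveOp3 α p = 0)
    (hcone : ∀ (x : EuclideanSpace ℝ (Fin 3)) (t : ℝ), 1 ≤ t → t ≤ ‖x‖ → α (x, t) = 0)
    (hbdry : ∀ (x : EuclideanSpace ℝ (Fin 3)) (t : ℝ), ‖x‖ = 1 → -1 < t → t ≤ 3 →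
      α (x, t) = 0)
    {x : EuclideanSpace ℝ (Fin 3)} {t : ℝ} (hx : 1 ≤ ‖x‖) (hxt : ‖x‖ ≤ t) (ht : t ≤ 3) :
    α (x, t) = 0 := by
  set Ω : Set Spacetime := {p | 1 < ‖p.1‖ ∧ ‖p.1‖ < p.2} with hΩdef
  have hΩ : IsOpen Ω := (isOpen_lt continuous_const continuous_fst.norm).inter
    (isOpen_lt continuous_fst.norm continuous_snd)
  have hΩ0 : ∀ p ∈ Ω, p.1 ≠ 0 := fun p hp => norm_pos_iff.1 (by linarith [hp.1])
  have hu : ContDiffOn ℝ 2 α Ω := hsm.mono fun p hp =>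
    ⟨hΩ0 p hp, by linarith [hp.1, hp.2], hp.2.le⟩
  obtain ⟨C, hC0, hC⟩ := exists_bounds_above_cone hsm hcone hbdry
  obtain ⟨M, hM0, hM⟩ := exists_abs_deriv_steepStep_mul_le
  set f : ℝ → ℝ := fun t => -timeWeight 2 t with hf
  have hfc : ContDiff ℝ 1 f := (contDiff_timeWeight 2).neg
  have hf' : ∀ t, deriv f t = 4 * max (2 ^ 2 - (t - 1) ^ 2) 0 * (t - 1) := fun t => by
    rw [hf, deriv.fun_neg, deriv_timeWeight]; ring
  obtain ⟨B₁, hB₁⟩ := (isCompact_Icc (a := (1 : ℝ)) (b := 3)).exists_bound_of_continuousOn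
    hfc.continuous.continuousOn
  obtain ⟨B₂, hB₂⟩ := (isCompact_Icc (a := (1 : ℝ)) (b := 3)).exists_bound_of_continuousOn
    (hfc.continuous_deriv (by simp)).continuousOn
  have hflate : ∀ t, 1 < t → 3 < t → f t = 0 ∧ deriv f t = 0 := fun t h1 h3 => by
    have hneg : (2 : ℝ) ^ 2 - (t - 1) ^ 2 ≤ 0 := by nlinarith
    exact ⟨by simp [hf, timeWeight, posSq_of_nonpos hneg], by simp [hf', max_eq_right hneg]⟩
  set χ : ℕ → Spacetime → ℝ := fun n =>
    coneCutoff f (fun r => steepStep n (r - 1)) (steepStep n) with hχ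
  have hsupp : ∀ n, tsupport (χ n) ⊆ Ω ∩ Metric.closedBall 0 3 := fun n => by
    have hε : (0 : ℝ) < 1 / (n + 1) := by positivity
    have hcl : IsClosed {p : Spacetime | 1 / ((n : ℝ) + 1) ≤ ‖p.1‖ - 1 ∧
        1 / ((n : ℝ) + 1) ≤ p.2 - ‖p.1‖ ∧ p.2 ≤ 3} :=
      (isClosed_le continuous_const (continuous_fst.norm.sub continuous_const)).inter
        ((isClosed_le continuous_const (continuous_snd.sub continuous_fst.norm)).inter
          (isClosed_le continuous_snd continuous_const))
    refine (closure_minimal ?_ hcl).trans ?_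
    · intro p hp
      have hp' : f p.2 * steepStep n (‖p.1‖ - 1) * steepStep n (p.2 - ‖p.1‖) ≠ 0 := hp
      have hG := le_of_steepStep_ne_zero (right_ne_zero_of_mul (left_ne_zero_of_mul hp'))
      have hH := le_of_steepStep_ne_zero (right_ne_zero_of_mul hp')
      refine ⟨hG, hH, ?_⟩
      by_contra! h3
      exact left_ne_zero_of_mul (left_ne_zero_of_mul hp') (hflate _ (by linarith) h3).1
    · rintro p ⟨h1, h2, h3⟩
      refine ⟨⟨by linarith, by linarith⟩, ?_⟩
      rw [mem_closedBall_zero_iff, Prod.norm_def, max_le_iff, Real.norm_eq_abs, abs_le]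
      exact ⟨by linarith, by linarith, h3⟩
  have hχc : ∀ n, ContDiffOn ℝ 1 (χ n) Ω := fun n p hp =>
    (contDiffAt_coneCutoff hfc (contDiff_wallStep n) (contDiff_steepStep n)
      (hΩ0 p hp)).contDiffWithinAt
  have hcompact : ∀ n, HasCompactSupport (χ n) := fun n =>
    (isCompact_closedBall (0 : Spacetime) 3).of_isClosed_subset (isClosed_tsupport _)
      ((hsupp n).trans inter_subset_right)
  have hF := fun n => continuous_and_integral_currentPairing_eq_zero hΩ hu
    (fun p hp => hpde p hp.1 hp.2) (hχc n) (hcompact n) ((hsupp n).trans inter_subset_left)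
  have hformula : ∀ n, ∀ p ∈ Ω, currentPairing (χ n) α p =
      deriv f p.2 * steepStep n (‖p.1‖ - 1) * steepStep n (p.2 - ‖p.1‖) * energyDensity α p
      + f p.2 * steepStep n (‖p.1‖ - 1) * deriv (steepStep n) (p.2 - ‖p.1‖) * coneEnergy α p
      - f p.2 * deriv (steepStep n) (‖p.1‖ - 1) * steepStep n (p.2 - ‖p.1‖) *
        (timeDeriv α p * radialDeriv α p) := fun n p hp => by
    rw [hχ, currentPairing_coneCutoff hfc (contDiff_wallStep n) (contDiff_steepStep n) α
      (hΩ0 p hp), deriv_comp_sub_const]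
  have hout : ∀ n, ∀ p ∉ Ω, currentPairing (χ n) α p = 0 := fun n p hp =>
    currentPairing_eq_zero_of_notMem_tsupport α fun h => hp (hsupp n h).1
  have key := eq_zero_of_tendsto_of_integral_eq_zero hΩ
    (Φ := Ω.indicator fun p => deriv f p.2 * energyDensity α p) (R := 3)
    (C := max B₁ B₂ * 1 * (2 * C ^ 2 + 3 * C) + max B₁ B₂ * (M * (4 * C ^ 2))
      + max B₁ B₂ * 1 * (M * C * (2 * C ^ 2 + 3 * C)))
    (fun n => (hF n).1) (fun n => (hF n).2) ?_ ?_ ?_ ?_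
  · rcases hx.eq_or_lt with h | h1
    · exact hbdry x t h.symm (by linarith) ht
    rcases hxt.eq_or_lt with h | h2
    · exact hcone x t (by linarith) h.ge
    rw [← eq_of_timeDeriv_eq_zero (u := α) (x := x) h2 ?_ ?_ ?_]
    · exact hcone x _ hx le_rfl
    · refine hsm.continuousOn.comp (by fun_prop) fun s hs => ?_
      exact ⟨norm_pos_iff.1 (by linarith), by linarith [hs.1], hs.1⟩
    · intro s hs
      have hmem : ((x, s) : Spacetime) ∈ Ω := ⟨h1, hs.1⟩
      exact (hu.contDiffAt (hΩ.mem_nhds hmem)).differentiableAt (by simp)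
    · intro s hs
      have hmem : ((x, s) : Spacetime) ∈ Ω := ⟨h1, hs.1⟩
      have h0 := key _ hmem
      rw [indicator_of_mem hmem, hf', mul_eq_zero] at h0
      refine timeDeriv_eq_zero_of_energyDensity_eq_zero (h0.resolve_left ?_)
      have hs1 : 0 < s - 1 := by linarith [hs.1]
      have hs3 : s < 3 := by linarith [hs.2]
      have : 0 < max ((2 : ℝ) ^ 2 - (s - 1) ^ 2) 0 := lt_max_of_lt_left (by nlinarith)
      exact (mul_pos (mul_pos (by norm_num) this) hs1).ne'
  · intro n p
    by_cases hp : p ∈ Ω ∧ p.2 ≤ 3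
    · obtain ⟨hp, h3⟩ := hp
      have h1 : 1 < ‖p.1‖ := hp.1
      have h2 : ‖p.1‖ < p.2 := hp.2
      have hball : p ∈ Metric.closedBall (0 : Spacetime) 3 := by
        rw [mem_closedBall_zero_iff, Prod.norm_def, max_le_iff, Real.norm_eq_abs, abs_le]
        exact ⟨by linarith, by linarith, h3⟩
      obtain ⟨hb1, hb2, hb3⟩ := hC p h1 h2 h3
      have hIcc : p.2 ∈ Icc (1 : ℝ) 3 := ⟨by linarith, h3⟩
      rw [indicator_of_mem hball, hformula n p hp]
      refine abs_weighted_current_le ((hB₁ _ hIcc).trans (le_max_left _ _))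
        ((hB₂ _ hIcc).trans (le_max_right _ _)) (abs_steepStep_le_one _ _)
        (abs_steepStep_le_one _ _) (energyDensity_nonneg _ _)
        ((energyDensity_le hb1).trans (by linarith)) (coneEnergy_nonneg _ _) ?_ ?_
        ((abs_radialDeriv_le hb1).trans (by nlinarith [sq_nonneg C]))
      · have hq := coneEnergy_le_of_abs_le hb3
        have hs : 0 ≤ p.2 - ‖p.1‖ := by linarith
        calc |deriv (steepStep n) (p.2 - ‖p.1‖)| * coneEnergy α p
            ≤ |deriv (steepStep n) (p.2 - ‖p.1‖)| * (2 * (C * (p.2 - ‖p.1‖)) ^ 2) := by gcongr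
          _ = (|deriv (steepStep n) (p.2 - ‖p.1‖)| * (p.2 - ‖p.1‖)) *
              (2 * C ^ 2 * (p.2 - ‖p.1‖)) := by ring
          _ ≤ M * (2 * C ^ 2 * 2) := by
              gcongr
              · exact hM n _ hs
              · linarith
          _ = M * (4 * C ^ 2) := by ring
      · calc |deriv (steepStep n) (‖p.1‖ - 1)| * |timeDeriv α p|
            ≤ |deriv (steepStep n) (‖p.1‖ - 1)| * (C * (‖p.1‖ - 1)) := by gcongr
          _ = |deriv (steepStep n) (‖p.1‖ - 1)| * (‖p.1‖ - 1) * C := by ring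
          _ ≤ M * C := by
              gcongr
              exact hM n _ (by linarith)
    · have hz : currentPairing (χ n) α p = 0 := by
        by_cases hpΩ : p ∈ Ω
        · have h3 : 3 < p.2 := not_le.1 fun h => hp ⟨hpΩ, h⟩
          have := hflate p.2 (by linarith) h3
          rw [hformula n p hpΩ, this.1, this.2]
          ring
        · exact hout n p hpΩ
      rw [hz, abs_zero]
      refine indicator_nonneg (fun _ _ => ?_) p
      have hB : 0 ≤ max B₁ B₂ :=
        (norm_nonneg _).trans ((hB₁ 1 (by norm_num)).trans (le_max_left _ _))
      positivity
  · intro p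
    by_cases hp : p ∈ Ω
    · rw [indicator_of_mem hp]
      refine tendsto_const_nhds.congr' ?_
      filter_upwards [eventually_steepStep_eq_one (sub_pos.2 hp.1),
        eventually_steepStep_eq_one (sub_pos.2 hp.2)] with n hn1 hn2
      rw [hformula n p hp, hn1.1, hn1.2, hn2.1, hn2.2]
      ring
    · rw [indicator_of_notMem hp]
      exact tendsto_const_nhds.congr fun n => (hout n p hp).symm
  · refine indicator_nonneg fun p hp => mul_nonneg ?_ (energyDensity_nonneg _ _)
    rw [hf']
    have : 0 ≤ p.2 - 1 := by linarith [hp.1, hp.2]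
    positivity
  · refine ContinuousOn.congr ?_ fun p hp => indicator_of_mem hp _
    exact ((hfc.continuous_deriv (by simp)).comp continuous_snd).continuousOn.mul
      (continuousOn_energyDensity hΩ hu)

theorem waveOp3_eq_zero_of_eventuallyEq_zero {u : Spacetime → ℝ} {p : Spacetime}
    (h : u =ᶠ[𝓝 p] fun _ => 0) : waveOp3 u p = 0 := by
  have hu : ContDiffAt ℝ 2 u p := contDiffAt_const.congr_of_eventuallyEq h
  have hdir : ∀ v, dir2 u p v = 0 := fun v => by
    have hd : (fun q => fderiv ℝ u q v) =ᶠ[𝓝 p] fun _ => 0 := by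
      filter_upwards [h.fderiv (𝕜 := ℝ)] with q hq
      simp [hq]
    rw [dir2_eq_fderiv_fderiv hu, hd.fderiv_eq]
    simp
  simp [waveOp3, hdir]

theorem exists_bounds_below_cone {α : Spacetime → ℝ} {t₀ R : ℝ} (ht₀ : -1 < t₀) (ht₁ : t₀ < 1)
    (hsm : ContDiffOn ℝ 2 α {p : Spacetime | p.1 ≠ 0 ∧ -‖p.1‖ < p.2 ∧ p.2 ≤ ‖p.1‖})
    (hbdry : ∀ (x : EuclideanSpace ℝ (Fin 3)) (t : ℝ), ‖x‖ = 1 → -1 < t → t ≤ 3 →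
      α (x, t) = 0) :
    ∃ C, 0 ≤ C ∧ ∀ p : Spacetime, 1 < ‖p.1‖ → ‖p.1‖ ≤ R → t₀ ≤ p.2 → p.2 ≤ 1 →
      ‖fderiv ℝ α p‖ ≤ C ∧ |timeDeriv α p| ≤ C * (‖p.1‖ - 1) := by
  set S : Set Spacetime := {p | p.1 ≠ 0 ∧ -‖p.1‖ < p.2 ∧ p.2 ≤ ‖p.1‖} with hS
  set K : Set Spacetime := {p | 1 ≤ ‖p.1‖ ∧ ‖p.1‖ ≤ R ∧ t₀ ≤ p.2 ∧ p.2 ≤ 1} with hK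
  have hKS : K ⊆ S := by
    rintro p ⟨h1, -, h2, h3⟩
    exact ⟨norm_pos_iff.1 (by linarith), by linarith, by linarith⟩
  have hKc : IsCompact K := by
    refine Metric.isCompact_of_isClosed_isBounded ?_ ?_
    · exact (isClosed_le continuous_const continuous_fst.norm).inter
        ((isClosed_le continuous_fst.norm continuous_const).inter
          ((isClosed_le continuous_const continuous_snd).inter
            (isClosed_le continuous_snd continuous_const)))
    · refine (Metric.isBounded_closedBall (x := (0 : Spacetime)) (r := R)).subset ?_
      rintro p ⟨h1, h2, h3, h4⟩
      rw [mem_closedBall_zero_iff, Prod.norm_def, max_le_iff, Real.norm_eq_abs, abs_le]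
      exact ⟨by linarith, by linarith, by linarith⟩
  obtain ⟨C, hC0, hC1, hC2⟩ := exists_bound_fderivWithin uniqueDiffOn_below_cone hsm hKc hKS
  refine ⟨C, hC0, fun p h1 hR h2 h3 => ?_⟩
  have hpK : p ∈ K := ⟨h1.le, hR, h2, h3⟩
  have hnhds : S ∈ 𝓝 p := by
    have : {q : Spacetime | 1 < ‖q.1‖} ∩ ({q : Spacetime | -1 < q.2} ∩
        {q : Spacetime | q.2 < ‖q.1‖}) ∈ 𝓝 p :=
      ((isOpen_lt continuous_const continuous_fst.norm).inter
        ((isOpen_lt continuous_const continuous_snd).inter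
          (isOpen_lt continuous_snd continuous_fst.norm))).mem_nhds
        ⟨h1, lt_of_lt_of_le ht₀ h2, lt_of_le_of_lt h3 h1⟩
    filter_upwards [this] with q hq
    have hq1 : 1 < ‖q.1‖ := hq.1
    have hq2 : -1 < q.2 := hq.2.1
    have hq3 : q.2 < ‖q.1‖ := hq.2.2
    exact ⟨norm_pos_iff.1 (by linarith), by linarith, hq3.le⟩
  have hfd : fderivWithin ℝ α S p = fderiv ℝ α p := fderivWithin_of_mem_nhds hnhds
  refine ⟨hfd ▸ hC1 p hpK, ?_⟩
  rw [timeDeriv, ← hfd]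
  refine abs_fderivWithin_time_le_near_wall (hsm.differentiableOn (by simp)) hC2 ht₁
    (fun q hq => hq.2.2) (fun q hq => hq.1) ?_ ?_ hpK
  · rintro q ⟨hq1, hq2, hq3⟩ c ⟨hc1, hc2⟩
    have hq0 : 0 < ‖q.1‖ := by linarith
    have hc0 : 0 < c := (inv_pos.2 hq0).trans_le hc1
    have hn : ‖c • q.1‖ = c * ‖q.1‖ := by rw [norm_smul, Real.norm_eq_abs, abs_of_pos hc0]
    refine ⟨?_, ?_, hq3⟩
    · rw [hn]
      rwa [inv_le_iff_one_le_mul₀ hq0] at hc1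
    · rw [hn]
      nlinarith
  · intro x t hx ht
    refine ⟨⟨norm_pos_iff.1 (by linarith), ?_, ?_⟩,
      hbdry x t hx (by linarith [ht.1]) (by linarith [ht.2])⟩
    · change -‖x‖ < t
      linarith [ht.1]
    · change t ≤ ‖x‖
      linarith [ht.2]

/-- Uniqueness for the backward exterior problem in `{|x| ≥ 1, -1 < t ≤ 1}`. -/
theorem eq_zero_below_cone {α : Spacetime → ℝ}
    (hsm : ContDiffOn ℝ 2 α {p : Spacetime | p.1 ≠ 0 ∧ -‖p.1‖ < p.2 ∧ p.2 ≤ ‖p.1‖})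
    (hpde : ∀ p : Spacetime, 1 < ‖p.1‖ → -‖p.1‖ < p.2 → p.2 < ‖p.1‖ → waveOp3 α p = 0)
    (hzero : ∀ (x : EuclideanSpace ℝ (Fin 3)) (t : ℝ), 1 ≤ ‖x‖ → 1 ≤ t → t ≤ 3 →
      α (x, t) = 0)
    (hbdry : ∀ (x : EuclideanSpace ℝ (Fin 3)) (t : ℝ), ‖x‖ = 1 → -1 < t → t ≤ 3 →
      α (x, t) = 0)
    {x₀ : EuclideanSpace ℝ (Fin 3)} {t₀ : ℝ} (hx₀ : 1 < ‖x₀‖) (ht₀ : -1 < t₀) (ht₁ : t₀ < 1) :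
    α (x₀, t₀) = 0 := by
  set Ω : Set Spacetime := {p | 1 < ‖p.1‖ ∧ -1 < p.2 ∧ p.2 < 3} with hΩdef
  have hΩ : IsOpen Ω := (isOpen_lt continuous_const continuous_fst.norm).inter
    ((isOpen_lt continuous_const continuous_snd).inter
      (isOpen_lt continuous_snd continuous_const))
  have hΩ0 : ∀ p ∈ Ω, p.1 ≠ 0 := fun p hp => norm_pos_iff.1 (by linarith [hp.1])
  have hlate : ∀ p ∈ Ω, 1 < p.2 → α =ᶠ[𝓝 p] fun _ => 0 := fun p hp h1 => by
    filter_upwards [hΩ.mem_nhds hp, (isOpen_lt continuous_const continuous_snd).mem_nhds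
      (show p ∈ {q : Spacetime | 1 < q.2} from h1)] with q hq hq1
    exact hzero q.1 q.2 hq.1.le (LT.lt.le hq1) hq.2.2.le
  have hu : ContDiffOn ℝ 2 α Ω := fun p hp => by
    rcases lt_or_ge p.2 ‖p.1‖ with h | h
    · have hnhds : {q : Spacetime | q.1 ≠ 0 ∧ -‖q.1‖ < q.2 ∧ q.2 ≤ ‖q.1‖} ∈ 𝓝 p := by
        filter_upwards [hΩ.mem_nhds hp, (isOpen_lt continuous_snd continuous_fst.norm).mem_nhds
          (show p ∈ {q : Spacetime | q.2 < ‖q.1‖} from h)] with q hq hq1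
        exact ⟨hΩ0 q hq, by linarith [hq.1, hq.2.1], LT.lt.le hq1⟩
      exact (hsm.contDiffAt hnhds).contDiffWithinAt
    · exact (contDiffAt_const.congr_of_eventuallyEq
        (hlate p hp (hp.1.trans_le h))).contDiffWithinAt
  have hw : ∀ p ∈ Ω, waveOp3 α p = 0 := fun p hp => by
    rcases lt_or_ge p.2 ‖p.1‖ with h | h
    · exact hpde p hp.1 (by linarith [hp.1, hp.2.1]) h
    · exact waveOp3_eq_zero_of_eventuallyEq_zero (hlate p hp (hp.1.trans_le h))
  set R : ℝ := ‖x₀‖ + 2 with hR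
  obtain ⟨C, hC0, hC⟩ := exists_bounds_below_cone (R := R + 1) ht₀ ht₁ hsm hbdry
  have hC' : ∀ p ∈ Ω, t₀ ≤ p.2 → ‖p.1‖ ≤ R + p.2 →
      ‖fderiv ℝ α p‖ ≤ C ∧ |timeDeriv α p| ≤ C * (‖p.1‖ - 1) := fun p hp h1 h2 => by
    rcases le_or_gt p.2 1 with h | h
    · exact hC p hp.1 (by linarith) h1 h
    · have hz : fderiv ℝ α p = 0 := by
        rw [(hlate p hp h).fderiv_eq]
        simp
      simp only [timeDeriv, hz, norm_zero, zero_apply, abs_zero]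
      exact ⟨hC0, mul_nonneg hC0 (by linarith [hp.1])⟩
  obtain ⟨M, hM0, hM⟩ := exists_abs_deriv_steepStep_mul_le
  set f : ℝ → ℝ := timeWeight (1 - t₀) with hf
  have hfc : ContDiff ℝ 1 f := contDiff_timeWeight _
  have hf' : ∀ t, deriv f t = 4 * max ((1 - t₀) ^ 2 - (t - 1) ^ 2) 0 * (1 - t) :=
    deriv_timeWeight _
  obtain ⟨B₁, hB₁⟩ := (isCompact_Icc (a := t₀) (b := 2 - t₀)).exists_bound_of_continuousOn
    hfc.continuous.continuousOn
  obtain ⟨B₂, hB₂⟩ := (isCompact_Icc (a := t₀) (b := 2 - t₀)).exists_bound_of_continuousOn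
    (hfc.continuous_deriv (by simp)).continuousOn
  have hfout : ∀ t, t ∉ Icc t₀ (2 - t₀) → f t = 0 ∧ deriv f t = 0 := fun t h => by
    have hneg : (1 - t₀) ^ 2 - (t - 1) ^ 2 ≤ 0 := by
      rw [mem_Icc, not_and_or, not_le, not_le] at h
      rcases h with h | h <;> nlinarith
    exact ⟨by simp [hf, timeWeight, posSq_of_nonpos hneg], by simp [hf', max_eq_right hneg]⟩
  set H : ℝ → ℝ := fun s => posSq (s + R) with hH
  have hHc : ContDiff ℝ 1 H := contDiff_posSq.comp (by fun_prop)
  have hH' : ∀ s, deriv H s = 2 * max (s + R) 0 := fun s => by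
    rw [hH, deriv_comp_add_const, (hasDerivAt_posSq _).deriv]
  have hHnn : ∀ s, 0 ≤ H s := fun s => sq_nonneg _
  obtain ⟨L₁, hL₁⟩ := (isCompact_Icc (a := -R) (b := 3)).exists_bound_of_continuousOn
    hHc.continuous.continuousOn
  obtain ⟨L₂, hL₂⟩ := (isCompact_Icc (a := -R) (b := 3)).exists_bound_of_continuousOn
    (hHc.continuous_deriv (by simp)).continuousOn
  have hHout : ∀ s, s < -R → H s = 0 ∧ deriv H s = 0 := fun s h => by
    have hneg : s + R ≤ 0 := by linarith
    exact ⟨by simp [hH, posSq_of_nonpos hneg], by simp [hH', max_eq_right hneg]⟩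
  have hball : ∀ p : Spacetime, p.2 ∈ Icc t₀ (2 - t₀) → ‖p.1‖ ≤ R + p.2 →
      p ∈ Metric.closedBall (0 : Spacetime) (R + 3) := fun p hp h => by
    rw [mem_closedBall_zero_iff, Prod.norm_def, max_le_iff, Real.norm_eq_abs, abs_le]
    exact ⟨by linarith [hp.2], by linarith [hp.1], by linarith [hp.2]⟩
  set χ : ℕ → Spacetime → ℝ := fun n =>
    coneCutoff f (fun r => steepStep n (r - 1)) H with hχ
  have hsupp : ∀ n, tsupport (χ n) ⊆ Ω ∩ Metric.closedBall 0 (R + 3) := fun n => by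
    have hε : (0 : ℝ) < 1 / (n + 1) := by positivity
    have hcl : IsClosed {p : Spacetime | 1 / ((n : ℝ) + 1) ≤ ‖p.1‖ - 1 ∧
        ‖p.1‖ ≤ R + p.2 ∧ t₀ ≤ p.2 ∧ p.2 ≤ 2 - t₀} :=
      (isClosed_le continuous_const (continuous_fst.norm.sub continuous_const)).inter
        ((isClosed_le continuous_fst.norm (continuous_const.add continuous_snd)).inter
          ((isClosed_le continuous_const continuous_snd).inter
            (isClosed_le continuous_snd continuous_const)))
    refine (closure_minimal ?_ hcl).trans ?_
    · intro p hp
      have hp' : f p.2 * steepStep n (‖p.1‖ - 1) * H (p.2 - ‖p.1‖) ≠ 0 := hp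
      have hG := le_of_steepStep_ne_zero (right_ne_zero_of_mul (left_ne_zero_of_mul hp'))
      refine ⟨hG, ?_, ?_⟩
      · by_contra! h
        exact right_ne_zero_of_mul hp' (hHout _ (by linarith)).1
      · by_contra h
        exact left_ne_zero_of_mul (left_ne_zero_of_mul hp') (hfout _ h).1
    · rintro p ⟨h1, h2, h3⟩
      exact ⟨⟨by linarith, by linarith [h3.1], by linarith [h3.2]⟩, hball p h3 h2⟩
  have hχc : ∀ n, ContDiffOn ℝ 1 (χ n) Ω := fun n p hp =>
    (contDiffAt_coneCutoff hfc (contDiff_wallStep n) hHc (hΩ0 p hp)).contDiffWithinAt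
  have hcompact : ∀ n, HasCompactSupport (χ n) := fun n =>
    (isCompact_closedBall (0 : Spacetime) (R + 3)).of_isClosed_subset (isClosed_tsupport _)
      ((hsupp n).trans inter_subset_right)
  have hF := fun n => continuous_and_integral_currentPairing_eq_zero hΩ hu hw
    (hχc n) (hcompact n) ((hsupp n).trans inter_subset_left)
  have hformula : ∀ n, ∀ p ∈ Ω, currentPairing (χ n) α p =
      deriv f p.2 * steepStep n (‖p.1‖ - 1) * H (p.2 - ‖p.1‖) * energyDensity α p
      + f p.2 * steepStep n (‖p.1‖ - 1) * deriv H (p.2 - ‖p.1‖) * coneEnergy α p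
      - f p.2 * deriv (steepStep n) (‖p.1‖ - 1) * H (p.2 - ‖p.1‖) *
        (timeDeriv α p * radialDeriv α p) := fun n p hp => by
    rw [hχ, currentPairing_coneCutoff hfc (contDiff_wallStep n) hHc α (hΩ0 p hp),
      deriv_comp_sub_const]
  have hout : ∀ n, ∀ p ∉ Ω, currentPairing (χ n) α p = 0 := fun n p hp =>
    currentPairing_eq_zero_of_notMem_tsupport α fun h => hp (hsupp n h).1
  have hfirst : ∀ p ∈ Ω, 0 ≤ deriv f p.2 * H (p.2 - ‖p.1‖) * energyDensity α p := fun p hp => by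
    rcases le_or_gt p.2 1 with h | h
    · refine mul_nonneg (mul_nonneg ?_ (hHnn _)) (energyDensity_nonneg _ _)
      rw [hf']
      have : 0 ≤ 1 - p.2 := by linarith
      positivity
    · have hz : fderiv ℝ α p = 0 := by
        rw [(hlate p hp h).fderiv_eq]
        simp
      simp [energyDensity, timeDeriv, spaceDeriv, hz]
  have hsecond : ∀ p : Spacetime, 0 ≤ f p.2 * deriv H (p.2 - ‖p.1‖) * coneEnergy α p :=
    fun p => by
      refine mul_nonneg (mul_nonneg (sq_nonneg _) ?_) (coneEnergy_nonneg _ _)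
      rw [hH']
      positivity
  have key := eq_zero_of_tendsto_of_integral_eq_zero hΩ
    (Φ := Ω.indicator fun p => deriv f p.2 * H (p.2 - ‖p.1‖) * energyDensity α p +
      f p.2 * deriv H (p.2 - ‖p.1‖) * coneEnergy α p) (R := R + 3)
    (C := max B₁ B₂ * L₁ * (2 * C ^ 2 + 3 * C) + max B₁ B₂ * (L₂ * (2 * (2 * C) ^ 2))
      + max B₁ B₂ * L₁ * (M * C * (2 * C ^ 2 + 3 * C)))
    (fun n => (hF n).1) (fun n => (hF n).2) ?_ ?_ ?_ ?_
  · rw [eq_of_timeDeriv_eq_zero (u := α) (x := x₀) ht₁ ?_ ?_ ?_]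
    · exact hzero x₀ 1 hx₀.le le_rfl (by norm_num)
    · refine hsm.continuousOn.comp (by fun_prop) fun s hs => ?_
      exact ⟨norm_pos_iff.1 (by linarith), by linarith [hs.1], by linarith [hs.2]⟩
    · intro s hs
      have hmem : ((x₀, s) : Spacetime) ∈ Ω := ⟨hx₀, by linarith [hs.1], by linarith [hs.2]⟩
      exact (hu.contDiffAt (hΩ.mem_nhds hmem)).differentiableAt (by simp)
    · intro s hs
      have hmem : ((x₀, s) : Spacetime) ∈ Ω := ⟨hx₀, by linarith [hs.1], by linarith [hs.2]⟩
      have h0 := key _ hmem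
      rw [indicator_of_mem hmem] at h0
      have h1 := ((add_eq_zero_iff_of_nonneg (hfirst _ hmem) (hsecond _)).1 h0).1
      refine timeDeriv_eq_zero_of_energyDensity_eq_zero
        ((mul_eq_zero.1 h1).resolve_left (mul_pos ?_ ?_).ne')
      · rw [hf']
        have : 0 < max ((1 - t₀) ^ 2 - (s - 1) ^ 2) 0 :=
          lt_max_of_lt_left (by nlinarith [hs.1, hs.2])
        exact mul_pos (mul_pos (by norm_num) this) (by linarith [hs.2])
      · exact pow_pos (lt_max_of_lt_left (by simp only [hR]; linarith [hs.1])) 2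
  · intro n p
    by_cases hp : p ∈ Ω ∧ p.2 ∈ Icc t₀ (2 - t₀) ∧ ‖p.1‖ ≤ R + p.2
    · obtain ⟨hp, hIcc, h2⟩ := hp
      have h1 : 1 < ‖p.1‖ := hp.1
      obtain ⟨hb1, hb2⟩ := hC' p hp hIcc.1 h2
      have hsIcc : p.2 - ‖p.1‖ ∈ Icc (-R) 3 := ⟨by linarith, by linarith [hp.2.2]⟩
      rw [indicator_of_mem (hball p hIcc h2), hformula n p hp]
      refine abs_weighted_current_le ((hB₁ _ hIcc).trans (le_max_left _ _))
        ((hB₂ _ hIcc).trans (le_max_right _ _)) (abs_steepStep_le_one _ _)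
        (hL₁ _ hsIcc) (energyDensity_nonneg _ _)
        ((energyDensity_le hb1).trans (by linarith)) (coneEnergy_nonneg _ _) ?_ ?_
        ((abs_radialDeriv_le hb1).trans (by nlinarith [sq_nonneg C]))
      · refine mul_le_mul (hL₂ _ hsIcc) (coneEnergy_le_of_abs_le fun i => ?_)
          (coneEnergy_nonneg _ _) ((norm_nonneg _).trans (hL₂ _ hsIcc))
        refine (abs_add_le _ _).trans ?_
        rw [abs_mul]
        have := mul_le_mul (abs_coord_div_norm_le_one p.1 i) (abs_timeDeriv_le hb1)
          (abs_nonneg _) zero_le_one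
        linarith [abs_spaceDeriv_le hb1 i]
      · calc |deriv (steepStep n) (‖p.1‖ - 1)| * |timeDeriv α p|
            ≤ |deriv (steepStep n) (‖p.1‖ - 1)| * (C * (‖p.1‖ - 1)) := by gcongr
          _ = |deriv (steepStep n) (‖p.1‖ - 1)| * (‖p.1‖ - 1) * C := by ring
          _ ≤ M * C := by
              gcongr
              exact hM n _ (by linarith)
    · have hz : currentPairing (χ n) α p = 0 := by
        by_cases hpΩ : p ∈ Ω
        · rw [hformula n p hpΩ]
          by_cases hIcc : p.2 ∈ Icc t₀ (2 - t₀)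
          · have h3 : R + p.2 < ‖p.1‖ := not_le.1 fun h => hp ⟨hpΩ, hIcc, h⟩
            have := hHout (p.2 - ‖p.1‖) (by linarith)
            rw [this.1, this.2]
            ring
          · rw [(hfout _ hIcc).1, (hfout _ hIcc).2]
            ring
        · exact hout n p hpΩ
      rw [hz, abs_zero]
      refine indicator_nonneg (fun _ _ => ?_) p
      have hB : 0 ≤ max B₁ B₂ :=
        (norm_nonneg _).trans ((hB₁ 1 ⟨by linarith, by linarith⟩).trans (le_max_left _ _))
      have h0 : (0 : ℝ) ∈ Icc (-R) 3 := ⟨by linarith, by norm_num⟩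
      have hL1 : 0 ≤ L₁ := (norm_nonneg _).trans (hL₁ 0 h0)
      have hL2 : 0 ≤ L₂ := (norm_nonneg _).trans (hL₂ 0 h0)
      positivity
  · intro p
    by_cases hp : p ∈ Ω
    · rw [indicator_of_mem hp]
      refine tendsto_const_nhds.congr' ?_
      filter_upwards [eventually_steepStep_eq_one (sub_pos.2 hp.1)] with n hn
      rw [hformula n p hp, hn.1, hn.2]
      ring
    · rw [indicator_of_notMem hp]
      exact tendsto_const_nhds.congr fun n => (hout n p hp).symm
  · exact indicator_nonneg fun p hp => add_nonneg (hfirst p hp) (hsecond p)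
  · refine ContinuousOn.congr ?_ fun p hp => indicator_of_mem hp _
    have hs : Continuous fun p : Spacetime => p.2 - ‖p.1‖ := by fun_prop
    refine ((((hfc.continuous_deriv (by simp)).comp continuous_snd).mul
      (hHc.continuous.comp hs)).continuousOn.mul (continuousOn_energyDensity hΩ hu)).add
      (((hfc.continuous.comp continuous_snd).mul
        ((hHc.continuous_deriv (by simp)).comp hs)).continuousOn.mul
          (continuousOn_coneEnergy hΩ hu hΩ0))

/-- Lemma 5.2 (uniqueness for the exterior problem): a continuous function on
`K = {(x,t) : x ≠ 0, −|x| < t}`, smooth on each side of the cone `t = |x|`, solving the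
free wave equation for `|x| > 1`, vanishing for `1 ≤ t ≤ |x|` and vanishing on
`S × (−1, 3]`, vanishes on `{|x| ≥ 1} × (−1, 3]`. -/
theorem exterior_problem_uniqueness
    (α : EuclideanSpace ℝ (Fin 3) × ℝ → ℝ)
    (hα_cont : ContinuousOn α {p : EuclideanSpace ℝ (Fin 3) × ℝ | p.1 ≠ 0 ∧ -‖p.1‖ < p.2})
    (hα_smooth_up : ContDiffOn ℝ (⊤ : ℕ∞) α
      {p : EuclideanSpace ℝ (Fin 3) × ℝ | p.1 ≠ 0 ∧ -‖p.1‖ < p.2 ∧ ‖p.1‖ ≤ p.2})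
    (hα_smooth_down : ContDiffOn ℝ (⊤ : ℕ∞) α
      {p : EuclideanSpace ℝ (Fin 3) × ℝ | p.1 ≠ 0 ∧ -‖p.1‖ < p.2 ∧ p.2 ≤ ‖p.1‖})
    (hα_pde_up : ∀ p : EuclideanSpace ℝ (Fin 3) × ℝ, 1 < ‖p.1‖ → ‖p.1‖ < p.2 →
      waveOp3 α p = 0)
    (hα_pde_down : ∀ p : EuclideanSpace ℝ (Fin 3) × ℝ, 1 < ‖p.1‖ → -‖p.1‖ < p.2 →
      p.2 < ‖p.1‖ → waveOp3 α p = 0)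
    (hα_cone : ∀ (x : EuclideanSpace ℝ (Fin 3)) (t : ℝ), 1 ≤ t → t ≤ ‖x‖ → α (x, t) = 0)
    (hα_bdry : ∀ (x : EuclideanSpace ℝ (Fin 3)) (t : ℝ), ‖x‖ = 1 → -1 < t → t ≤ 3 →
      α (x, t) = 0) :
    ∀ (x : EuclideanSpace ℝ (Fin 3)) (t : ℝ), 1 ≤ ‖x‖ → -1 < t → t ≤ 3 → α (x, t) = 0 := by
  have hsm_up := hα_smooth_up.of_le (m := 2) (WithTop.coe_le_coe.2 (le_top : (2 : ℕ∞) ≤ ⊤))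
  have hsm_down := hα_smooth_down.of_le (m := 2) (WithTop.coe_le_coe.2 (le_top : (2 : ℕ∞) ≤ ⊤))
  have hzero : ∀ (x : EuclideanSpace ℝ (Fin 3)) (t : ℝ), 1 ≤ ‖x‖ → 1 ≤ t → t ≤ 3 →
      α (x, t) = 0 := fun x t hx h1 h3 => by
    rcases le_total t ‖x‖ with h | h
    · exact hα_cone x t h1 h
    · exact eq_zero_above_cone hsm_up hα_pde_up hα_cone hα_bdry hx h h3
  intro x t hx ht h3
  rcases le_or_gt 1 t with h1 | h1
  · exact hzero x t hx h1 h3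
  rcases hx.eq_or_lt with h | h
  · exact hα_bdry x t h.symm ht h3
  · exact eq_zero_below_cone hsm_down hα_pde_down hzero hα_bdry h ht h1
end

section
/- Let n > 1 and let a > 1, c > 0, d > 0, λ > 0 and T > 0 be real numbers. Define φ(y,z,t) = c(a−z)² + d‖y‖² − (t−z)² for y ∈ ℝ^{n−1}, z ∈ ℝ, t ∈ ℝ, and ψ = e^{λφ}. For σ > 0 let h(σ) = sup over (y,z) in the closed unit ball of ℝⁿ of ∫_{−T}^{T} exp(2σ(ψ(y,z,t) − ψ(y,z,z))) dt. Then h(σ) → 0 as σ → ∞. -/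
open MeasureTheory Filter

/-- For `0 ≤ x ≤ R`, the decay `exp (-x) - 1` is at most linear with slope `-1 / (1 + R)`. -/
lemma exp_neg_sub_one_le_of_le {x R : ℝ} (hx : 0 ≤ x) (hxR : x ≤ R) :
    Real.exp (-x) - 1 ≤ -(x / (1 + R)) := by
  have h1 : Real.exp (-x) ≤ 1 / (1 + x) := by
    rw [Real.exp_neg, ← one_div]
    exact one_div_le_one_div_of_le (by linarith) (by linarith [Real.add_one_le_exp x])
  have h2 : x / (1 + R) ≤ x / (1 + x) :=
    div_le_div_of_nonneg_left hx (by linarith) (by linarith)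
  have h3 : 1 / (1 + x) = 1 - x / (1 + x) := by
    field_simp
    ring
  linarith

/-- For `0 ≤ A` and `0 ≤ x ≤ R`, subtracting `x` in the exponent lowers `exp A` by at least
`x / (1 + R)`. -/
lemma exp_sub_sub_exp_le {A x R : ℝ} (hA : 0 ≤ A) (hx : 0 ≤ x) (hxR : x ≤ R) :
    Real.exp (A - x) - Real.exp A ≤ -(x / (1 + R)) := by
  have h1 := exp_neg_sub_one_le_of_le hx hxR
  have h2 : Real.exp (-x) ≤ 1 := Real.exp_le_one_iff.mpr (by linarith)
  have h3 : Real.exp (A - x) = Real.exp A * Real.exp (-x) := by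
    rw [← Real.exp_add, sub_eq_add_neg]
  nlinarith [Real.one_le_exp hA]

/-- An integral over any set is bounded by a full Gaussian integral as soon as the integrand is
dominated there by a translated Gaussian. -/
lemma setIntegral_exp_le_sqrt_of_le {s : Set ℝ} (hs : MeasurableSet s) {f : ℝ → ℝ} {b z : ℝ}
    (hb : 0 < b) (hf : ∀ t ∈ s, f t ≤ -b * (t - z) ^ 2) :
    ∫ t in s, Real.exp (f t) ≤ √(Real.pi / b) := by
  have hint : Integrable fun t : ℝ => Real.exp (-b * (t - z) ^ 2) :=
    (integrable_exp_neg_mul_sq hb).comp_sub_right z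
  calc ∫ t in s, Real.exp (f t)
      ≤ ∫ t in s, Real.exp (-b * (t - z) ^ 2) := by
        refine integral_mono_of_nonneg (Eventually.of_forall fun t => (Real.exp_pos _).le)
          hint.integrableOn ?_
        filter_upwards [ae_restrict_mem hs] with t ht
        exact Real.exp_le_exp.mpr (hf t ht)
    _ ≤ ∫ t, Real.exp (-b * (t - z) ^ 2) :=
        setIntegral_le_integral hint (Eventually.of_forall fun t => (Real.exp_pos _).le)
    _ = √(Real.pi / b) := by
        rw [integral_sub_right_eq_self (fun t : ℝ => Real.exp (-b * t ^ 2)) z, integral_gaussian]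

/-- Lemma 3.2: with `φ(y,z,t) = c(a−z)² + d‖y‖² − (t−z)²` and `ψ = e^{λφ}`,
the quantity `h(σ) = sup_{(y,z) ∈ B̄} ∫_{−T}^{T} e^{2σ(ψ(y,z,t) − ψ(y,z,z))} dt`
tends to `0` as `σ → ∞`. -/
theorem planewave_weight_integral_tendsto_zero (m : ℕ) (hm : 1 ≤ m)
    (a c d lam T : ℝ) (ha : 1 < a) (hc : 0 < c) (hd : 0 < d)
    (hlam : 0 < lam) (hT : 0 < T) :
    Tendsto
      (fun σ : ℝ =>
        ⨆ p : {p : EuclideanSpace ℝ (Fin m) × ℝ // ‖p.1‖ ^ 2 + p.2 ^ 2 ≤ 1},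
          ∫ t in Set.Icc (-T) T,
            Real.exp (2 * σ *
              (Real.exp (lam * (c * (a - p.1.2) ^ 2 + d * ‖p.1.1‖ ^ 2 - (t - p.1.2) ^ 2))
                - Real.exp (lam * (c * (a - p.1.2) ^ 2 + d * ‖p.1.1‖ ^ 2
                    - (p.1.2 - p.1.2) ^ 2)))))
      atTop (nhds 0) := by
  set R := lam * (T + 1) ^ 2 with hR
  have hR0 : 0 < 1 + R := by positivity
  set k := 2 * (lam / (1 + R)) with hk
  have hk0 : 0 < k := by positivity
  have hlim : Tendsto (fun σ : ℝ => √(Real.pi / (k * σ))) atTop (nhds 0) := by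
    have h := (tendsto_id.const_mul_atTop hk0).const_div_atTop Real.pi
    simpa using h.sqrt
  refine squeeze_zero' (Eventually.of_forall fun σ => ?_) ?_ hlim
  · exact Real.iSup_nonneg fun p => integral_nonneg fun t => (Real.exp_pos _).le
  filter_upwards [eventually_gt_atTop 0] with σ hσ
  refine Real.iSup_le ?_ (Real.sqrt_nonneg _)
  rintro ⟨⟨y, z⟩, hyz⟩
  refine setIntegral_exp_le_sqrt_of_le (z := z) measurableSet_Icc (mul_pos hk0 hσ)
    fun t ht => ?_
  have hz : |z| ≤ 1 := by
    rw [← sq_le_one_iff_abs_le_one]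
    have := sq_nonneg ‖y‖
    dsimp only at hyz
    linarith
  obtain ⟨hz1, hz2⟩ := abs_le.mp hz
  have hsq : (t - z) ^ 2 ≤ (T + 1) ^ 2 :=
    sq_le_sq' (by linarith [ht.1]) (by linarith [ht.2])
  have hA : 0 ≤ lam * (c * (a - z) ^ 2 + d * ‖y‖ ^ 2) := by positivity
  have key := exp_sub_sub_exp_le hA (mul_nonneg hlam.le (sq_nonneg (t - z)))
    (mul_le_mul_of_nonneg_left hsq hlam.le)
  rw [← mul_sub] at key
  simp only [sub_self, ne_eq, OfNat.ofNat_ne_zero, not_false_eq_true, zero_pow, sub_zero]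
  calc _ ≤ 2 * σ * -(lam * (t - z) ^ 2 / (1 + R)) :=
        mul_le_mul_of_nonneg_left key (by positivity)
    _ = -(k * σ) * (t - z) ^ 2 := by rw [hk]; ring
end

section
/- Let ε ∈ (0,1], a > 4 and λ > 0 be real numbers, let D = {x ∈ ℝ³ : ε ≤ ‖x‖ ≤ 1}, and define ψ(x,t) = exp(λ(a‖x‖² − (t−‖x‖)²)) for x ∈ ℝ³, t ∈ ℝ. For σ > 0 let g(σ) = sup over x ∈ D of ∫_{−1}^{3} exp(2σ(ψ(x,t) − ψ(x,‖x‖))) dt. Then g(σ) → 0 as σ → ∞. -/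
open MeasureTheory Filter

/-- On `|s| ≤ 3` the function `exp (-lam * s ^ 2) - 1` lies below a downward parabola. -/
lemma exp_neg_mul_sq_sub_one_le {lam s : ℝ} (hlam : 0 < lam) (hs : s ^ 2 ≤ 9) :
    Real.exp (-(lam * s ^ 2)) - 1 ≤ -(lam / (1 + 9 * lam) * s ^ 2) := by
  have hy : 0 ≤ lam * s ^ 2 := by positivity
  have hexp : Real.exp (-(lam * s ^ 2)) ≤ (1 + lam * s ^ 2)⁻¹ := by
    rw [Real.exp_neg]
    gcongr
    linarith [Real.add_one_le_exp (lam * s ^ 2)]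
  have hsplit : (1 + lam * s ^ 2)⁻¹ = 1 - lam * s ^ 2 / (1 + lam * s ^ 2) := by
    field_simp
    ring
  have hden : lam * s ^ 2 / (1 + 9 * lam) ≤ lam * s ^ 2 / (1 + lam * s ^ 2) := by
    exact div_le_div_of_nonneg_left hy (by positivity) (by nlinarith)
  have hcomm : lam / (1 + 9 * lam) * s ^ 2 = lam * s ^ 2 / (1 + 9 * lam) := by ring
  linarith

/-- The difference of the weight at time `t` and at its maximum `t = r` is at most a negative
multiple of `(t - r) ^ 2`. -/
lemma weight_sub_weight_le {a lam r t : ℝ} (ha : 0 ≤ a) (hlam : 0 < lam)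
    (hs : (t - r) ^ 2 ≤ 9) :
    Real.exp (lam * (a * r ^ 2 - (t - r) ^ 2)) - Real.exp (lam * (a * r ^ 2 - (r - r) ^ 2))
      ≤ -(lam / (1 + 9 * lam) * (t - r) ^ 2) := by
  have hfactor : Real.exp (lam * (a * r ^ 2 - (t - r) ^ 2))
        - Real.exp (lam * (a * r ^ 2 - (r - r) ^ 2))
      = Real.exp (lam * a * r ^ 2) * (Real.exp (-(lam * (t - r) ^ 2)) - 1) := by
    rw [mul_sub (Real.exp _), mul_one, ← Real.exp_add]
    ring_nf
  have hone : 1 ≤ Real.exp (lam * a * r ^ 2) := Real.one_le_exp (by positivity)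
  have hparabola := exp_neg_mul_sq_sub_one_le hlam hs
  have hnonneg : 0 ≤ lam / (1 + 9 * lam) * (t - r) ^ 2 := by positivity
  rw [hfactor]
  nlinarith

/-- The weighted time integral is bounded by a full Gaussian integral. -/
lemma setIntegral_exp_weight_le {a lam r σ : ℝ} (ha : 0 ≤ a) (hlam : 0 < lam)
    (hr : 0 ≤ r) (hr1 : r ≤ 1) (hσ : 0 < σ) :
    ∫ t in Set.Icc (-1 : ℝ) 3,
        Real.exp (2 * σ * (Real.exp (lam * (a * r ^ 2 - (t - r) ^ 2))
          - Real.exp (lam * (a * r ^ 2 - (r - r) ^ 2))))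
      ≤ √(Real.pi / (2 * σ * (lam / (1 + 9 * lam)))) := by
  set b := 2 * σ * (lam / (1 + 9 * lam)) with hb
  have hb0 : 0 < b := by positivity
  have hint : Integrable fun t : ℝ => Real.exp (-b * (t - r) ^ 2) :=
    (integrable_exp_neg_mul_sq hb0).comp_sub_right r
  calc _ ≤ ∫ t in Set.Icc (-1 : ℝ) 3, Real.exp (-b * (t - r) ^ 2) := by
        refine setIntegral_mono_on (Continuous.integrableOn_Icc (by fun_prop))
          hint.integrableOn measurableSet_Icc fun t ht => Real.exp_le_exp.2 ?_
        have hs : (t - r) ^ 2 ≤ 9 := by nlinarith [ht.1, ht.2]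
        calc _ ≤ 2 * σ * -(lam / (1 + 9 * lam) * (t - r) ^ 2) :=
              mul_le_mul_of_nonneg_left (weight_sub_weight_le ha hlam hs) (by positivity)
          _ = -b * (t - r) ^ 2 := by rw [hb]; ring
    _ ≤ ∫ t : ℝ, Real.exp (-b * (t - r) ^ 2) :=
        setIntegral_le_integral hint (Eventually.of_forall fun t => (Real.exp_pos _).le)
    _ = √(Real.pi / b) := by
        rw [integral_sub_right_eq_self (fun t : ℝ => Real.exp (-b * t ^ 2)) r,
          integral_gaussian]

/-- Lemma 5.5: with `ψ(x,t) = e^{λ(a‖x‖² − (t−‖x‖)²)}` and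
`D = {x ∈ ℝ³ : ε ≤ ‖x‖ ≤ 1}`, the quantity
`g(σ) = sup_{x ∈ D} ∫_{−1}^{3} e^{2σ(ψ(x,t) − ψ(x,‖x‖))} dt` tends to `0`
as `σ → ∞`. -/
theorem spherical_weight_integral_tendsto_zero (ε a lam : ℝ)
    (hε : 0 < ε) (hε1 : ε ≤ 1) (ha : 4 < a) (hlam : 0 < lam) :
    Tendsto
      (fun σ : ℝ =>
        ⨆ x : {x : EuclideanSpace ℝ (Fin 3) // ε ≤ ‖x‖ ∧ ‖x‖ ≤ 1},
          ∫ t in Set.Icc (-1 : ℝ) 3,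
            Real.exp (2 * σ *
              (Real.exp (lam * (a * ‖x.1‖ ^ 2 - (t - ‖x.1‖) ^ 2))
                - Real.exp (lam * (a * ‖x.1‖ ^ 2 - (‖x.1‖ - ‖x.1‖) ^ 2)))))
      atTop (nhds 0) := by
  have hbound : Tendsto (fun σ : ℝ => √(Real.pi / (2 * σ * (lam / (1 + 9 * lam)))))
      atTop (nhds 0) := by
    have hden : Tendsto (fun σ : ℝ => 2 * σ * (lam / (1 + 9 * lam))) atTop atTop :=
      (tendsto_id.const_mul_atTop two_pos).atTop_mul_const (by positivity)
    simpa using (hden.const_div_atTop Real.pi).sqrt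
  refine squeeze_zero' (Eventually.of_forall fun σ => Real.iSup_nonneg fun x =>
    integral_nonneg fun t => (Real.exp_pos _).le) ?_ hbound
  filter_upwards [eventually_gt_atTop 0] with σ hσ
  exact Real.iSup_le (fun x => setIntegral_exp_weight_le (by linarith) hlam
    (norm_nonneg _) x.2.2 hσ) (Real.sqrt_nonneg _)
end

section
/- Let m ≥ 1 be a natural number and let c, d be real numbers with c > 4 and d > c − 1. Then for every η ∈ ℝ^m and ζ, τ ∈ ℝ with (η,ζ,τ) ≠ (0,0,0) and τ² = ‖η‖² + ζ², one has −τ² + d‖η‖² + (c−1)ζ² − 2ζτ > 0. -/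
/-- Expanded pseudoconvexity condition for the plane wave Carleman weight:
for `c > 4`, `d > c − 1`, and `(η,ζ,τ) ≠ 0` on the characteristic set
`τ² = ‖η‖² + ζ²`, one has `−τ² + d‖η‖² + (c−1)ζ² − 2ζτ > 0`. -/
theorem planewave_pseudoconvexity (m : ℕ) (hm : 1 ≤ m) (c d : ℝ)
    (hc : 4 < c) (hd : c - 1 < d)
    (η : EuclideanSpace ℝ (Fin m)) (ζ τ : ℝ)
    (hne : ¬(η = 0 ∧ ζ = 0 ∧ τ = 0))
    (hchar : τ ^ 2 = ‖η‖ ^ 2 + ζ ^ 2) :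
    0 < -τ ^ 2 + d * ‖η‖ ^ 2 + (c - 1) * ζ ^ 2 - 2 * ζ * τ := by
  have hτ : 0 < τ ^ 2 := by
    refine lt_of_le_of_ne (sq_nonneg τ) fun h => hne ⟨?_, ?_, ?_⟩
    · exact norm_eq_zero.mp (pow_eq_zero_iff two_ne_zero |>.mp
        (by linarith [sq_nonneg ‖η‖, sq_nonneg ζ]))
    · exact pow_eq_zero_iff two_ne_zero |>.mp (by linarith [sq_nonneg ‖η‖, sq_nonneg ζ])
    · exact pow_eq_zero_iff two_ne_zero |>.mp h.symm
  have hη : (c - 1) * ‖η‖ ^ 2 ≤ d * ‖η‖ ^ 2 := by gcongr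
  have hcross : 2 * ζ * τ ≤ 2 * τ ^ 2 := by
    linarith [two_mul_le_add_sq ζ τ, sq_nonneg ‖η‖]
  calc 0 < (c - 4) * τ ^ 2 := mul_pos (by linarith) hτ
    _ = -τ ^ 2 + (c - 1) * ‖η‖ ^ 2 + (c - 1) * ζ ^ 2 - 2 * τ ^ 2 := by
      linear_combination (c - 1) * hchar
    _ ≤ -τ ^ 2 + d * ‖η‖ ^ 2 + (c - 1) * ζ ^ 2 - 2 * ζ * τ := by linarith
end

section
/- Let b > 3 be a real number. Then for every r > 0 and t ∈ ℝ with |r − t| ≤ |br + t|, one has ((b−1)r + t)(br + t)² − t(r − t)² − 2r(r − t)(br + t) > 0. -/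
/-- The radial pseudoconvexity inequality for the weight `φ(r,t) = (1/2)(br² + 2rt − t²)`:
for `b > 3`, `r > 0` and `|r − t| ≤ |br + t|`, one has
`((b−1)r + t)(br + t)² − t(r − t)² − 2r(r − t)(br + t) > 0`. -/
theorem radial_pseudoconvexity_ineq (b : ℝ) (hb : 3 < b) (r t : ℝ) (hr : 0 < r)
    (h : |r - t| ≤ |b * r + t|) :
    0 < ((b - 1) * r + t) * (b * r + t) ^ 2 - t * (r - t) ^ 2
        - 2 * r * (r - t) * (b * r + t) := by
  have hb₁ : 0 < b + 1 := by linarith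
  have hb₃ : 0 < b - 3 := by linarith
  have factorization : ((b - 1) * r + t) * (b * r + t) ^ 2 - t * (r - t) ^ 2
      - 2 * r * (r - t) * (b * r + t)
      = (b + 1) * r * ((b + 1) * (b - 3) * r ^ 2 + 3 * ((b - 1) * r + 2 * t) ^ 2) / 4 := by
    ring
  rw [factorization]
  positivity
end

section
/- Let n > 1, T > 6, and let a be a real number with 1 < a and 20a + 5 < (T−1)². Define φ(y,z,t) = 5(a−z)² + 5‖y‖² − (t−z)² for y ∈ ℝ^{n−1}, z, t ∈ ℝ. Then for all (y,z) and (y′,z′) in the closed unit ball of ℝⁿ, φ(y,z,z) > φ(y′,z′,T) and φ(y,z,z) > φ(y′,z′,−T). -/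
/-- The Carleman weight exponent for the plane wave problem. -/
noncomputable def planePhi {m : ℕ} (a : ℝ) (y : EuclideanSpace ℝ (Fin m)) (z t : ℝ) : ℝ :=
  5 * (a - z) ^ 2 + 5 * ‖y‖ ^ 2 - (t - z) ^ 2

theorem abs_le_one_of_normSq_add_sq_le_one {E : Type*} [SeminormedAddCommGroup E] {y : E} {z : ℝ}
    (h : ‖y‖ ^ 2 + z ^ 2 ≤ 1) : |z| ≤ 1 :=
  (sq_le_one_iff_abs_le_one z).mp (by linarith [sq_nonneg ‖y‖])

/-- Separation of the Carleman weight: for `T > 6` and `1 < a` with `20a + 5 < (T−1)²`,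
the value of `φ` on the characteristic surface `{t = z}` over the closed unit ball strictly
exceeds its value anywhere on the faces `{t = ±T}` over the closed unit ball. -/
theorem planePhi_separation (m : ℕ) (hm : 1 ≤ m) (T a : ℝ)
    (hT : 6 < T) (ha : 1 < a) (ha' : 20 * a + 5 < (T - 1) ^ 2)
    (y y' : EuclideanSpace ℝ (Fin m)) (z z' : ℝ)
    (h : ‖y‖ ^ 2 + z ^ 2 ≤ 1) (h' : ‖y'‖ ^ 2 + z' ^ 2 ≤ 1) :
    planePhi a y' z' T < planePhi a y z z ∧ planePhi a y' z' (-T) < planePhi a y z z := by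
  obtain ⟨hz₁, hz₂⟩ := abs_le.mp (abs_le_one_of_normSq_add_sq_le_one h)
  obtain ⟨hz₁', hz₂'⟩ := abs_le.mp (abs_le_one_of_normSq_add_sq_le_one h')
  have hlow : 5 * (a - 1) ^ 2 ≤ 5 * (a - z) ^ 2 + 5 * ‖y‖ ^ 2 := by
    nlinarith [sq_nonneg ‖y‖]
  have hupp : 5 * (a - z') ^ 2 + 5 * ‖y'‖ ^ 2 ≤ 5 * (a + 1) ^ 2 := by
    nlinarith
  have htop : (T - 1) ^ 2 ≤ (T - z') ^ 2 := by gcongr; linarith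
  have hbot : (T - 1) ^ 2 ≤ (-T - z') ^ 2 := by
    rw [show (-T - z') ^ 2 = (T + z') ^ 2 by ring]
    gcongr <;> linarith
  unfold planePhi
  constructor <;> linarith
end

section
/- Let ε and a be real numbers with 0 < ε, 9ε² < 1, 4 < a, and a(1 − 9ε²) < 4. Define φ(x,t) = a‖x‖² − (t − ‖x‖)² for x ∈ ℝ³, t ∈ ℝ. Then for every x ∈ ℝ³ with 3ε ≤ ‖x‖ ≤ 1 and every (x′,t′) with ‖x′‖ ≤ 1 such that either t′ = 3, or t′ = −‖x′‖, or (‖x′‖ ≤ 2ε and −1 ≤ t′ ≤ 3), one has φ(x,‖x‖) > φ(x′,t′). -/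
/-- The Carleman weight exponent for the spherical/point source problem. -/
noncomputable def sphericalPhi (a : ℝ) (x : EuclideanSpace ℝ (Fin 3)) (t : ℝ) : ℝ :=
  a * ‖x‖ ^ 2 - (t - ‖x‖) ^ 2

/-- Separation of the Carleman weight for the spherical/point source problem:
for `0 < ε`, `9ε² < 1`, `4 < a`, `a(1 − 9ε²) < 4`, the value of `φ` on the cone piece
`{(x,|x|) : 3ε ≤ |x| ≤ 1}` strictly exceeds its value on the top face `{t = 3, |x| ≤ 1}`,
on the lower cone `{t = −|x|, |x| ≤ 1}`, and on the inner cylinder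
`{|x| ≤ 2ε, −1 ≤ t ≤ 3}`. -/
theorem sphericalPhi_separation (ε a : ℝ) (hε : 0 < ε) (hε2 : 9 * ε ^ 2 < 1)
    (ha : 4 < a) (ha2 : a * (1 - 9 * ε ^ 2) < 4)
    (x x' : EuclideanSpace ℝ (Fin 3)) (t' : ℝ)
    (hx : 3 * ε ≤ ‖x‖) (hx1 : ‖x‖ ≤ 1) (hx' : ‖x'‖ ≤ 1)
    (hcase : t' = 3 ∨ t' = -‖x'‖ ∨ (‖x'‖ ≤ 2 * ε ∧ -1 ≤ t' ∧ t' ≤ 3)) :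
    sphericalPhi a x' t' < sphericalPhi a x ‖x‖ := by
  have hlower : a * (9 * ε ^ 2) ≤ sphericalPhi a x ‖x‖ := by
    have hsq : (3 * ε) ^ 2 ≤ ‖x‖ ^ 2 := by gcongr
    have := mul_le_mul_of_nonneg_left hsq (by linarith : 0 ≤ a)
    unfold sphericalPhi
    linarith
  refine lt_of_lt_of_le ?_ hlower
  have hr : 0 ≤ ‖x'‖ := norm_nonneg x'
  have hr1 : ‖x'‖ ^ 2 ≤ 1 := pow_le_one₀ hr hx'
  unfold sphericalPhi
  rcases hcase with rfl | rfl | ⟨hr2, -, -⟩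
  · have : a * ‖x'‖ ^ 2 ≤ a * 1 := by gcongr
    nlinarith
  · have : (a - 4) * ‖x'‖ ^ 2 ≤ (a - 4) * 1 := by gcongr
    linarith
  · have : a * ‖x'‖ ^ 2 ≤ a * (2 * ε) ^ 2 := by gcongr
    have : 0 < a * ε ^ 2 := by positivity
    linarith [sq_nonneg (t' - ‖x'‖)]
end

section
/- Let b : ℝ³ → ℂ be a smooth function with support contained in the annulus {x ∈ ℝ³ : 1/4 ≤ ‖x‖ ≤ 1}. Then there is a constant C > 0 such that for all ξ ∈ ℝ³ and all τ ∈ ℝ with τ ≠ 0, |∫_{ℝ³} b(x) e^{−i⟨x,ξ⟩} e^{i‖x‖τ} dx| ≤ C(1 + ‖ξ‖)²/τ². -/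
open MeasureTheory RealInnerProductSpace

namespace OscillatoryIntegral

open scoped ContDiff
open Complex (I)

theorem eventuallyEq_zero_of_notMem_tsupport_mul {E : Type*} [TopologicalSpace E]
    {f : E → ℂ} (g : E → ℂ) {x : E} (hx : x ∉ tsupport f) : (fun y => f y * g y) =ᶠ[nhds x] 0 := by
  filter_upwards [notMem_tsupport_iff_eventuallyEq.1 hx] with y hy
  simp [hy]

variable {E : Type*} [NormedAddCommGroup E] [InnerProductSpace ℝ E]

/-- Smooth compactly supported functions that vanish near the origin. -/
structure IsAmplitude (f : E → ℂ) : Prop where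
  contDiff : ContDiff ℝ ∞ f
  hasCompactSupport : HasCompactSupport f
  zero_notMem_tsupport : (0 : E) ∉ tsupport f

/-- The oscillating factor `e^{-i⟨x,ξ⟩} e^{i‖x‖τ}`. -/
noncomputable def phase (ξ : E) (τ : ℝ) (x : E) : ℂ :=
  Complex.exp (-I * (⟪x, ξ⟫ : ℝ)) * Complex.exp (I * (‖x‖ : ℝ) * (τ : ℝ))

/-- The `v`-component of the radial unit vector field `x / ‖x‖`. -/
noncomputable def radialCoord (v x : E) : ℂ := ((⟪x, v⟫ / ‖x‖ : ℝ) : ℂ)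

theorem norm_phase (ξ : E) (τ : ℝ) (x : E) : ‖phase ξ τ x‖ = 1 := by
  simp [phase, Complex.norm_exp]

theorem contDiffAt_phase (ξ : E) (τ : ℝ) {x : E} (hx : x ≠ 0) :
    ContDiffAt ℝ ∞ (phase ξ τ) x := by
  unfold phase
  have hnorm : ContDiffAt ℝ ∞ (fun x : E => ((‖x‖ : ℝ) : ℂ)) x :=
    Complex.ofRealCLM.contDiff.contDiffAt.comp x (contDiffAt_norm ℝ hx)
  have hinner : ContDiffAt ℝ ∞ (fun x : E => ((⟪x, ξ⟫ : ℝ) : ℂ)) x :=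
    Complex.ofRealCLM.contDiff.contDiffAt.comp x (contDiffAt_id.inner ℝ contDiffAt_const)
  exact (contDiffAt_const.mul hinner).cexp.mul
    ((contDiffAt_const.mul hnorm).mul contDiffAt_const).cexp

theorem contDiffAt_radialCoord (v : E) {x : E} (hx : x ≠ 0) :
    ContDiffAt ℝ ∞ (radialCoord v) x := by
  refine Complex.ofRealCLM.contDiff.contDiffAt.comp x ?_
  exact (contDiffAt_id.inner ℝ contDiffAt_const).div (contDiffAt_norm ℝ hx) (norm_ne_zero_iff.2 hx)

theorem hasLineDerivAt_phase (ξ v : E) (τ : ℝ) {x : E} (hx : x ≠ 0) :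
    HasLineDerivAt ℝ (phase ξ τ)
      (phase ξ τ x * (-I * (⟪v, ξ⟫ : ℝ) + I * τ * radialCoord v x)) x v := by
  have hline : HasDerivAt (fun t : ℝ => x + t • v) v 0 := by
    simpa using ((hasDerivAt_id (0 : ℝ)).smul_const v).const_add x
  have hinner : HasDerivAt (fun t : ℝ => ⟪x + t • v, ξ⟫) ⟪v, ξ⟫ 0 := by
    simpa using hline.inner ℝ (hasDerivAt_const (0 : ℝ) ξ)
  have hnorm : HasDerivAt (fun t : ℝ => ‖x + t • v‖) (⟪x, v⟫ / ‖x‖) 0 := by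
    have h := hline.norm_sq.sqrt (by simpa using hx)
    simp only [Real.sqrt_sq (norm_nonneg _), zero_smul, add_zero] at h
    convert h using 1
    ring
  have h := ((hinner.ofReal_comp.const_mul (-I)).cexp).mul
    (((hnorm.ofReal_comp.const_mul I).mul_const (τ : ℂ)).cexp)
  refine HasDerivAt.congr_deriv h ?_
  simp only [phase, radialCoord, zero_smul, add_zero]
  ring

namespace IsAmplitude

variable {f : E → ℂ}

theorem mul_contDiffAt (hf : IsAmplitude f) {g : E → ℂ}
    (hg : ∀ x ≠ 0, ContDiffAt ℝ ∞ g x) : IsAmplitude (fun x => f x * g x) where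
  contDiff := by
    refine contDiff_iff_contDiffAt.2 fun x => ?_
    by_cases hx : x = 0
    · subst hx
      exact contDiffAt_const.congr_of_eventuallyEq
        (eventuallyEq_zero_of_notMem_tsupport_mul g hf.zero_notMem_tsupport)
    · exact hf.contDiff.contDiffAt.mul (hg x hx)
  hasCompactSupport := hf.hasCompactSupport.mul_right
  zero_notMem_tsupport := fun h => hf.zero_notMem_tsupport (tsupport_mul_subset_left h)

theorem mul_radialCoord (hf : IsAmplitude f) (v : E) :
    IsAmplitude (fun x => f x * radialCoord v x) :=
  hf.mul_contDiffAt fun _ hx => contDiffAt_radialCoord v hx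

theorem mul_phase (hf : IsAmplitude f) (ξ : E) (τ : ℝ) :
    IsAmplitude (fun x => f x * phase ξ τ x) :=
  hf.mul_contDiffAt fun _ hx => contDiffAt_phase ξ τ hx

theorem fderiv_apply (hf : IsAmplitude f) (v : E) :
    IsAmplitude (fun x => fderiv ℝ f x v) where
  contDiff := (hf.contDiff.fderiv_right (by simp)).clm_apply contDiff_const
  hasCompactSupport := hf.hasCompactSupport.fderiv_apply ℝ v
  zero_notMem_tsupport := fun h =>
    hf.zero_notMem_tsupport (tsupport_fderiv_apply_subset ℝ v h)

theorem differentiable (hf : IsAmplitude f) : Differentiable ℝ f :=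
  hf.contDiff.differentiable (by simp)

theorem fderiv_mul_phase_apply (hf : IsAmplitude f) (ξ v : E) (τ : ℝ) (x : E) :
    fderiv ℝ (fun x => f x * phase ξ τ x) x v
      = fderiv ℝ f x v * phase ξ τ x - I * (⟪v, ξ⟫ : ℝ) * (f x * phase ξ τ x)
        + I * τ * (f x * radialCoord v x * phase ξ τ x) := by
  by_cases hx : x = 0
  · subst hx
    rw [(eventuallyEq_zero_of_notMem_tsupport_mul _ hf.zero_notMem_tsupport).fderiv_eq,
      (notMem_tsupport_iff_eventuallyEq.1 hf.zero_notMem_tsupport).fderiv_eq,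
      image_eq_zero_of_notMem_tsupport hf.zero_notMem_tsupport]
    simp
  · have hphase : DifferentiableAt ℝ (phase ξ τ) x :=
      (contDiffAt_phase ξ τ hx).differentiableAt (by simp)
    rw [fderiv_fun_mul hf.differentiable.differentiableAt hphase]
    simp only [add_apply, smul_apply, smul_eq_mul,
      ← hphase.lineDeriv_eq_fderiv, (hasLineDerivAt_phase ξ v τ hx).lineDeriv]
    ring

variable [FiniteDimensional ℝ E]

theorem sum_mul_radialCoord (hf : IsAmplitude f) (x : E) :
    ∑ i, f x * radialCoord (stdOrthonormalBasis ℝ E i) x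
      * radialCoord (stdOrthonormalBasis ℝ E i) x = f x := by
  by_cases hx : x = 0
  · subst hx
    simp [image_eq_zero_of_notMem_tsupport hf.zero_notMem_tsupport]
  · have hsum : ∑ i, (⟪x, stdOrthonormalBasis ℝ E i⟫ / ‖x‖) ^ 2 = 1 := by
      have h := (stdOrthonormalBasis ℝ E).sum_sq_norm_inner_left x
      simp only [Real.norm_eq_abs, sq_abs] at h
      simp only [div_pow, ← Finset.sum_div, h]
      exact div_self (by simpa using hx)
    simp only [radialCoord, mul_assoc, ← Finset.mul_sum, ← pow_two]
    exact_mod_cast (congrArg (fun r : ℝ => f x * (r : ℂ)) hsum).trans (by simp)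

variable [MeasurableSpace E] [BorelSpace E]

theorem integrable (hf : IsAmplitude f) : Integrable f :=
  hf.contDiff.continuous.integrable_of_hasCompactSupport hf.hasCompactSupport

theorem integral_fderiv_apply (hf : IsAmplitude f) (v : E) : ∫ x, fderiv ℝ f x v = 0 := by
  have h := integral_smul_fderiv_eq_neg_fderiv_smul_of_integrable (𝕜 := ℝ) (μ := volume)
    (f := fun _ : E => (1 : ℝ)) (g := f) (v := v) (by simp)
    (by simpa using (hf.fderiv_apply v).integrable) (by simpa using hf.integrable)
    (by fun_prop) fun _ _ => hf.differentiable.differentiableAt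
  simpa using h

/-- Integration by parts in the direction `v`. -/
theorem integral_mul_radialCoord_mul_phase (hf : IsAmplitude f) (ξ v : E) (τ : ℝ) :
    I * τ * ∫ x, f x * radialCoord v x * phase ξ τ x
      = I * (⟪v, ξ⟫ : ℝ) * (∫ x, f x * phase ξ τ x) - ∫ x, fderiv ℝ f x v * phase ξ τ x := by
  have h := (hf.mul_phase ξ τ).integral_fderiv_apply v
  simp only [hf.fderiv_mul_phase_apply] at h
  have hd := ((hf.fderiv_apply v).mul_phase ξ τ).integrable
  have hm := ((hf.mul_phase ξ τ).integrable).const_mul (I * (⟪v, ξ⟫ : ℝ))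
  have hr := (((hf.mul_radialCoord v).mul_phase ξ τ).integrable).const_mul (I * τ)
  rw [integral_add (by exact hd.sub hm) hr, integral_sub hd hm, integral_const_mul,
    integral_const_mul] at h
  linear_combination h

/-- One integration by parts in the radial variable. -/
theorem integral_mul_phase_eq_sum (hf : IsAmplitude f) (ξ : E) (τ : ℝ) :
    I * τ * ∫ x, f x * phase ξ τ x
      = ∑ i, (I * (⟪stdOrthonormalBasis ℝ E i, ξ⟫ : ℝ)
          * (∫ x, f x * radialCoord (stdOrthonormalBasis ℝ E i) x * phase ξ τ x)
        - ∫ x, fderiv ℝ (fun y => f y * radialCoord (stdOrthonormalBasis ℝ E i) y) x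
            (stdOrthonormalBasis ℝ E i) * phase ξ τ x) := by
  simp only [← (hf.mul_radialCoord _).integral_mul_radialCoord_mul_phase, ← Finset.mul_sum]
  rw [← integral_finsetSum _ fun i _ =>
    (((hf.mul_radialCoord _).mul_radialCoord _).mul_phase ξ τ).integrable]
  simp only [← Finset.sum_mul, hf.sum_mul_radialCoord]

/-- Non-stationary phase: each radial integration by parts gains a factor `(1 + ‖ξ‖) / |τ|`. -/
theorem exists_norm_integral_mul_phase_mul_le (N : ℕ) :
    ∀ {f : E → ℂ}, IsAmplitude f → ∃ C : ℝ, 0 ≤ C ∧ ∀ (ξ : E) (τ : ℝ),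
      |τ| ^ N * ‖∫ x, f x * phase ξ τ x‖ ≤ C * (1 + ‖ξ‖) ^ N := by
  induction N with
  | zero =>
    intro f _
    refine ⟨∫ x, ‖f x‖, integral_nonneg fun _ => norm_nonneg _, fun ξ τ => ?_⟩
    simpa [norm_phase] using norm_integral_le_integral_norm (fun x => f x * phase ξ τ x)
  | succ N ih =>
    intro f hf
    choose A hA0 hA using fun i => ih (hf.mul_radialCoord (stdOrthonormalBasis ℝ E i))
    choose B hB0 hB using fun i =>
      ih ((hf.mul_radialCoord (stdOrthonormalBasis ℝ E i)).fderiv_apply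
        (stdOrthonormalBasis ℝ E i))
    refine ⟨∑ i, (A i + B i), Finset.sum_nonneg fun i _ => add_nonneg (hA0 i) (hB0 i),
      fun ξ τ => ?_⟩
    have hnorm : |τ| * ‖∫ x, f x * phase ξ τ x‖ = ‖I * τ * ∫ x, f x * phase ξ τ x‖ := by
      simp
    rw [pow_succ, mul_assoc, hnorm, hf.integral_mul_phase_eq_sum]
    refine (mul_le_mul_of_nonneg_left (norm_sum_le _ _) (by positivity)).trans ?_
    rw [Finset.mul_sum, Finset.sum_mul]
    refine Finset.sum_le_sum fun i _ => ?_
    have hinner : |⟪stdOrthonormalBasis ℝ E i, ξ⟫| ≤ ‖ξ‖ := by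
      simpa using abs_real_inner_le_norm (stdOrthonormalBasis ℝ E i) ξ
    refine (mul_le_mul_of_nonneg_left (norm_sub_le _ _) (by positivity)).trans ?_
    rw [norm_mul, norm_mul, Complex.norm_I, one_mul, Complex.norm_real, Real.norm_eq_abs]
    have hAi := mul_le_mul hinner (hA i ξ τ) (by positivity) (norm_nonneg ξ)
    have hBi := hB i ξ τ
    have hA' : 0 ≤ A i * (1 + ‖ξ‖) ^ N := mul_nonneg (hA0 i) (by positivity)
    have hB' : 0 ≤ ‖ξ‖ * (B i * (1 + ‖ξ‖) ^ N) :=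
      mul_nonneg (norm_nonneg ξ) (mul_nonneg (hB0 i) (by positivity))
    rw [pow_succ (1 + ‖ξ‖)]
    linarith

end IsAmplitude

end OscillatoryIntegral

open OscillatoryIntegral in
/-- Oscillatory integral bound from Proposition 1.5: for smooth `b` supported in the
annulus `1/4 ≤ ‖x‖ ≤ 1`, `|∫ b(x) e^{−i x·ξ} e^{i‖x‖τ} dx| ≤ C(1+‖ξ‖)²/τ²`. -/
theorem oscillatory_integral_decay (b : EuclideanSpace ℝ (Fin 3) → ℂ)
    (hb : ContDiff ℝ (⊤ : ℕ∞) b)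
    (hsupp : ∀ x : EuclideanSpace ℝ (Fin 3), b x ≠ 0 → 1 / 4 ≤ ‖x‖ ∧ ‖x‖ ≤ 1) :
    ∃ C > 0, ∀ (ξ : EuclideanSpace ℝ (Fin 3)) (τ : ℝ), τ ≠ 0 →
      ‖∫ x : EuclideanSpace ℝ (Fin 3),
          b x * Complex.exp (-Complex.I * (⟪x, ξ⟫ : ℝ))
            * Complex.exp (Complex.I * (‖x‖ : ℝ) * (τ : ℝ))‖
        ≤ C * (1 + ‖ξ‖) ^ 2 / τ ^ 2 := by
  have hsub : tsupport b ⊆ {x | 1 / 4 ≤ ‖x‖ ∧ ‖x‖ ≤ 1} :=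
    closure_minimal (fun x hx => hsupp x hx)
      ((isClosed_le continuous_const continuous_norm).inter
        (isClosed_le continuous_norm continuous_const))
  have hamp : IsAmplitude b :=
    { contDiff := hb
      hasCompactSupport := (isCompact_closedBall 0 1).of_isClosed_subset (isClosed_tsupport b)
        fun x hx => by simpa using (hsub hx).2
      zero_notMem_tsupport := fun h => by
        have h0 := (hsub h).1
        norm_num at h0 }
  obtain ⟨C, hC0, hC⟩ := IsAmplitude.exists_norm_integral_mul_phase_mul_le 2 hamp
  refine ⟨C + 1, by linarith, fun ξ τ hτ => ?_⟩
  have hτ2 : 0 < τ ^ 2 := by positivity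
  have h := hC ξ τ
  rw [sq_abs] at h
  simp only [phase, ← mul_assoc] at h
  rw [le_div_iff₀ hτ2, mul_comm]
  exact h.trans (by gcongr; linarith)
end

section
/- Let C ≥ 0 and let s < −7/2 be real numbers. Let G : ℝ³×ℝ → ℂ be a measurable function such that |G(ξ,τ)| ≤ C|τ| for all (ξ,τ), and |G(ξ,τ)| ≤ C(1+‖ξ‖)²/|τ| for all ξ and all τ ≠ 0. Then ∫_ℝ ∫_{ℝ³} (1+‖ξ‖²)^s |G(ξ,τ)|² dξ dτ < ∞. -/
open MeasureTheory

/-- The two regimes `a ≤ C|τ|` and `a ≤ C(1+r)²/|τ|` combine into one bound that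
separates the variables and is integrable in `τ`. -/
lemma sq_le_of_le_mul_abs_of_le_div_abs {C a r τ : ℝ} (ha : 0 ≤ a)
    (hsmall : a ≤ C * |τ|) (hlarge : τ ≠ 0 → a ≤ C * (1 + r) ^ 2 / |τ|) :
    a ^ 2 ≤ 8 * C ^ 2 * (1 + r ^ 2) ^ 2 * (1 + τ ^ 2)⁻¹ := by
  have hτ : 0 < 1 + τ ^ 2 := by positivity
  have hr : 1 ≤ (1 + r ^ 2) ^ 2 := one_le_pow₀ (by nlinarith [sq_nonneg r])
  rw [← div_eq_mul_inv, le_div_iff₀ hτ]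
  rcases le_total |τ| 1 with h | h
  · have hτ1 : τ ^ 2 ≤ 1 := (sq_le_one_iff_abs_le_one τ).2 h
    have haC : a ^ 2 ≤ C ^ 2 := by
      calc a ^ 2 ≤ (C * |τ|) ^ 2 := by gcongr
        _ = C ^ 2 * τ ^ 2 := by rw [mul_pow, sq_abs]
        _ ≤ C ^ 2 := mul_le_of_le_one_right (sq_nonneg C) hτ1
    calc a ^ 2 * (1 + τ ^ 2) ≤ C ^ 2 * (1 + 1) := by gcongr
      _ ≤ 8 * C ^ 2 * 1 := by nlinarith [sq_nonneg C]
      _ ≤ 8 * C ^ 2 * (1 + r ^ 2) ^ 2 := by gcongr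
  · have hpos : 0 < |τ| := one_pos.trans_le h
    have hτ1 : 1 ≤ τ ^ 2 := (one_le_sq_iff_one_le_abs τ).2 h
    have hmul : a * |τ| ≤ C * (1 + r) ^ 2 :=
      (le_div_iff₀ hpos).1 (hlarge (abs_pos.1 hpos))
    have hbracket : (1 + r) ^ 2 ≤ 2 * (1 + r ^ 2) := by nlinarith [sq_nonneg (1 - r)]
    calc a ^ 2 * (1 + τ ^ 2) ≤ a ^ 2 * (τ ^ 2 + τ ^ 2) := by gcongr
      _ = 2 * (a * |τ|) ^ 2 := by rw [mul_pow, sq_abs]; ring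
      _ ≤ 2 * (C * (1 + r) ^ 2) ^ 2 := by gcongr
      _ = 2 * C ^ 2 * ((1 + r) ^ 2) ^ 2 := by ring
      _ ≤ 2 * C ^ 2 * (2 * (1 + r ^ 2)) ^ 2 := by gcongr
      _ = 8 * C ^ 2 * (1 + r ^ 2) ^ 2 := by ring

/-- The integrability computation of Proposition 1.5: if `|G(ξ,τ)| ≤ C|τ|` and
`|G(ξ,τ)| ≤ C(1+‖ξ‖)²/|τ|` for `τ ≠ 0`, then for any `s < −7/2`,
`∫∫ (1+‖ξ‖²)^s |G(ξ,τ)|² dξ dτ < ∞`. -/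
theorem sobolev_weight_integrability (C s : ℝ) (hC : 0 ≤ C) (hs : s < -(7 / 2 : ℝ))
    (G : EuclideanSpace ℝ (Fin 3) × ℝ → ℂ) (hG : Measurable G)
    (h1 : ∀ p : EuclideanSpace ℝ (Fin 3) × ℝ, ‖G p‖ ≤ C * |p.2|)
    (h2 : ∀ p : EuclideanSpace ℝ (Fin 3) × ℝ, p.2 ≠ 0 →
      ‖G p‖ ≤ C * (1 + ‖p.1‖) ^ 2 / |p.2|) :
    (∫⁻ p : EuclideanSpace ℝ (Fin 3) × ℝ,
        ENNReal.ofReal ((1 + ‖p.1‖ ^ 2) ^ s * ‖G p‖ ^ 2)) < ⊤ := by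
  have hξ : Integrable fun ξ : EuclideanSpace ℝ (Fin 3) ↦ (1 + ‖ξ‖ ^ 2) ^ (s + 2) := by
    have h := integrable_rpow_neg_one_add_norm_sq (E := EuclideanSpace ℝ (Fin 3))
      (μ := volume) (r := -2 * (s + 2)) (by rw [finrank_euclideanSpace_fin]; push_cast; linarith)
    rwa [show -(-2 * (s + 2)) / 2 = s + 2 by ring] at h
  have hprod : Integrable fun p : EuclideanSpace ℝ (Fin 3) × ℝ ↦
      8 * C ^ 2 * ((1 + ‖p.1‖ ^ 2) ^ (s + 2) * (1 + p.2 ^ 2)⁻¹) :=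
    (hξ.mul_prod integrable_inv_one_add_sq).const_mul _
  refine (lintegral_mono fun p ↦ ENNReal.ofReal_le_ofReal ?_).trans_lt hprod.lintegral_lt_top
  have hw : 0 < 1 + ‖p.1‖ ^ 2 := by positivity
  calc (1 + ‖p.1‖ ^ 2) ^ s * ‖G p‖ ^ 2
      ≤ (1 + ‖p.1‖ ^ 2) ^ s * (8 * C ^ 2 * (1 + ‖p.1‖ ^ 2) ^ 2 * (1 + p.2 ^ 2)⁻¹) := by
        gcongr
        exact sq_le_of_le_mul_abs_of_le_div_abs (norm_nonneg _) (h1 p) (h2 p)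
    _ = 8 * C ^ 2 * ((1 + ‖p.1‖ ^ 2) ^ (s + 2) * (1 + p.2 ^ 2)⁻¹) := by
        rw [Real.rpow_add hw, Real.rpow_two]
        ring
end
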